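/- arXiv:0704.3127 — 3 statements merged into one kernel-verified Lean document; each statement's English description precedes it below -/
import Mathlib

section
/- Let A be a prime superalgebra over F possessing a minimal graded right ideal, and let * be a superinvolution of A. Then exactly one of the following holds: (i) there exists a primitive idempotent e ∈ A₀ with e* = e; (ii) A₁ = 0 and there exists a primitive idempotent e with e·H(A,*)·e* = 0; in this case eAe is a field and there exist u ∈ eAe* and v ∈ e*Ae with u* = −u, v* = −v, uv = e and vu = e*; (iii) there exists a primitive idempotent e with e·A₀·e* = 0; in this case e can be chosen so that there exist u ∈ eA₁e* with u* = u and v ∈ e*A₁e with v* = −v, such that uv = e and vu = e*. -/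
section Core

variable (F : Type*) {A : Type*} [Field F] [Ring A] [Algebra F A]
variable (𝒜 : ZMod 2 → Submodule F A)

/-- A superinvolution (a graded additive bijection reversing products with the Koszul
sign, of order two). -/
def IsAddSuperInvolution (σ : A ≃+ A) : Prop :=
  (∀ (i : ZMod 2), ∀ x ∈ 𝒜 i, σ x ∈ 𝒜 i) ∧
  (∀ (i j : ZMod 2), ∀ x ∈ 𝒜 i, ∀ y ∈ 𝒜 j,
    σ (x * y) = ((-1 : A) ^ (i.val * j.val)) * (σ y * σ x)) ∧
  (∀ x, σ (σ x) = x)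

/-- A graded right ideal (as an additive subgroup). -/
def IsGradedRightIdeal [GradedAlgebra 𝒜] (I : AddSubgroup A) : Prop :=
  (∀ x ∈ I, ∀ a : A, x * a ∈ I) ∧
  (∀ x ∈ I, ∀ i : ZMod 2, ((DirectSum.decompose 𝒜 x i : 𝒜 i) : A) ∈ I)

/-- A graded two-sided ideal (as an additive subgroup). -/
def IsGradedTwoSidedIdeal [GradedAlgebra 𝒜] (I : AddSubgroup A) : Prop :=
  (∀ x ∈ I, ∀ a : A, x * a ∈ I ∧ a * x ∈ I) ∧
  (∀ x ∈ I, ∀ i : ZMod 2, ((DirectSum.decompose 𝒜 x i : 𝒜 i) : A) ∈ I)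

/-- Primeness: the product of two nonzero graded two-sided ideals is nonzero. -/
def SuperPrime [GradedAlgebra 𝒜] : Prop :=
  ∀ I J : AddSubgroup A, IsGradedTwoSidedIdeal F 𝒜 I → IsGradedTwoSidedIdeal F 𝒜 J →
    I ≠ ⊥ → J ≠ ⊥ → ∃ x ∈ I, ∃ y ∈ J, x * y ≠ 0

/-- A minimal graded right ideal. -/
def IsMinimalGradedRightIdeal [GradedAlgebra 𝒜] (I : AddSubgroup A) : Prop :=
  IsGradedRightIdeal F 𝒜 I ∧ I ≠ ⊥ ∧
  ∀ J : AddSubgroup A, IsGradedRightIdeal F 𝒜 J → J ≤ I → J = ⊥ ∨ J = I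

/-- A primitive idempotent: an even idempotent `e` such that `eAe` is a division
superalgebra (with unit `e`). -/
def IsPrimitiveIdem (e : A) : Prop :=
  e ∈ 𝒜 0 ∧ e * e = e ∧ e ≠ 0 ∧
  ∀ (i : ZMod 2) (x : A), x ∈ 𝒜 i → e * x * e ≠ 0 →
    ∃ y : A, (e * x * e) * (e * y * e) = e ∧ (e * y * e) * (e * x * e) = e

end Core

section Cases

variable (F : Type*) {A : Type*} [Field F] [Ring A] [Algebra F A]
variable (𝒜 : ZMod 2 → Submodule F A) (σ : A ≃+ A)

/-- Case (i): a primitive idempotent fixed by the superinvolution. -/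
def CaseI : Prop := ∃ e : A, IsPrimitiveIdem F 𝒜 e ∧ σ e = e

/-- Case (ii): `A₁ = 0` and there is a primitive idempotent `e` with `e·H(A,*)·e* = 0`;
moreover `eAe` is commutative (a field) and there are skew elements `u ∈ eAe*`,
`v ∈ e*Ae` with `uv = e`, `vu = e*`. -/
def CaseII : Prop :=
  (∀ x ∈ 𝒜 1, x = 0) ∧
  ∃ e : A, IsPrimitiveIdem F 𝒜 e ∧ (∀ x : A, σ x = x → e * x * σ e = 0) ∧
    (∀ x y : A, (e * x * e) * (e * y * e) = (e * y * e) * (e * x * e)) ∧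
    ∃ u v : A, (∃ x : A, u = e * x * σ e) ∧ (∃ x : A, v = σ e * x * e) ∧
      σ u = -u ∧ σ v = -v ∧ u * v = e ∧ v * u = σ e

/-- Case (iii): a primitive idempotent `e` with `e·A₀·e* = 0`; moreover `e` can be chosen
so that there are `u ∈ eA₁e*` with `u* = u` and `v ∈ e*A₁e` with `v* = -v` satisfying
`uv = e`, `vu = e*`. -/
def CaseIII : Prop :=
  (∃ e : A, IsPrimitiveIdem F 𝒜 e ∧ ∀ x ∈ 𝒜 0, e * x * σ e = 0) ∧
  ∃ e : A, IsPrimitiveIdem F 𝒜 e ∧ (∀ x ∈ 𝒜 0, e * x * σ e = 0) ∧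
    ∃ u v : A, (∃ x ∈ 𝒜 1, u = e * x * σ e) ∧ (∃ x ∈ 𝒜 1, v = σ e * x * e) ∧
      σ u = u ∧ σ v = -v ∧ u * v = e ∧ v * u = σ e

end Cases

namespace SuperInvolution

theorem eq_of_mul_eq {A : Type*} [Ring A] {e f u v w : A} (hwu : w * u = f)
    (hwe : w * e = w) (huv : u * v = e) (hfv : f * v = v) : w = v := by
  rw [← hwe, ← huv, ← mul_assoc, hwu, hfv]

section Graded

variable {F : Type*} {A : Type*} [Field F] [Ring A] [Algebra F A]
variable {𝒜 : ZMod 2 → Submodule F A}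

theorem eq_zero_of_eq_neg (hchar : (2 : F) ≠ 0) {a : A} (h : a = -a) : a = 0 := by
  have h2 : (2 : F) • a = 0 := by
    rw [two_smul]
    nth_rewrite 1 [h]
    exact neg_add_cancel a
  exact (smul_eq_zero.mp h2).resolve_left hchar

theorem add_self_zmod_two (i : ZMod 2) : i + i = 0 := CharTwo.add_self_eq_zero i

theorem zmod_two_cases (i : ZMod 2) : i = 0 ∨ i = 1 := by
  revert i
  decide

variable [GradedAlgebra 𝒜]

theorem mem_mul_self {i : ZMod 2} {x y : A} (hx : x ∈ 𝒜 i) (hy : y ∈ 𝒜 i) :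
    x * y ∈ 𝒜 0 := by
  have h := SetLike.mul_mem_graded hx hy
  rwa [add_self_zmod_two] at h

theorem even_mul_mem {i : ZMod 2} {x y : A} (hx : x ∈ 𝒜 0) (hy : y ∈ 𝒜 i) :
    x * y ∈ 𝒜 i := by
  have h := SetLike.mul_mem_graded hx hy
  rwa [zero_add] at h

theorem mul_even_mem {i : ZMod 2} {x y : A} (hx : x ∈ 𝒜 i) (hy : y ∈ 𝒜 0) :
    x * y ∈ 𝒜 i := by
  have h := SetLike.mul_mem_graded hx hy
  rwa [add_zero] at h

variable (𝒜) in
theorem eq_zero_of_components {x : A}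
    (h : ∀ i, ((DirectSum.decompose 𝒜 x i : 𝒜 i) : A) = 0) : x = 0 := by
  apply (DirectSum.decompose 𝒜).injective
  ext i
  simp [h i]

theorem mul_component_eq_zero {i : ZMod 2} {p w : A} (hp : p ∈ 𝒜 i) (h : p * w = 0)
    (k : ZMod 2) : p * (DirectSum.decompose 𝒜 w k : 𝒜 k) = 0 := by
  rw [← DirectSum.coe_decompose_mul_add_of_left_mem 𝒜 hp, h]
  simp

theorem component_mul_eq_zero {i : ZMod 2} {p w : A} (hp : p ∈ 𝒜 i) (h : w * p = 0)
    (k : ZMod 2) : (DirectSum.decompose 𝒜 w k : 𝒜 k) * p = 0 := by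
  rw [← DirectSum.coe_decompose_mul_add_of_right_mem 𝒜 hp, h]
  simp

/-- In a graded-prime superalgebra, `aAb ≠ 0` for nonzero `a` and nonzero homogeneous `b`. -/
theorem exists_mul_mul_ne_zero (hprime : SuperPrime F 𝒜) {j : ZMod 2} {a b : A}
    (hb : b ∈ 𝒜 j) (ha0 : a ≠ 0) (hb0 : b ≠ 0) :
    ∃ k, ∃ x ∈ 𝒜 k, a * x * b ≠ 0 := by
  by_contra! hcon
  have hab : ∀ x, a * x * b = 0 := fun x => by
    induction x using DirectSum.Decomposition.inductionOn 𝒜 with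
    | zero => simp
    | homogeneous m => exact hcon _ _ m.2
    | add m n hm hn => rw [mul_add, add_mul, hm, hn, add_zero]
  let I : AddSubgroup A :=
    { carrier := {z | ∀ x, z * x * b = 0}
      zero_mem' := fun x => by simp
      add_mem' := fun {z w} hz hw x => by
        rw [add_mul, add_mul, hz x, hw x, add_zero]
      neg_mem' := fun {z} hz x => by rw [neg_mul, neg_mul, hz x, neg_zero] }
  have hIg : ∀ z ∈ I, ∀ k : ZMod 2, ((DirectSum.decompose 𝒜 z k : 𝒜 k) : A) ∈ I := by
    intro z hz k x
    induction x using DirectSum.Decomposition.inductionOn 𝒜 with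
    | zero => simp
    | homogeneous m =>
      rw [mul_assoc]
      exact component_mul_eq_zero (SetLike.mul_mem_graded m.2 hb)
        (by rw [← mul_assoc]; exact hz _) k
    | add m n hm hn => rw [mul_add, add_mul, hm, hn, add_zero]
  let J : AddSubgroup A :=
    { carrier := {w | ∀ z ∈ I, ∀ x, z * x * w = 0}
      zero_mem' := fun z _ x => by simp
      add_mem' := fun {w w'} hw hw' z hz x => by
        rw [mul_add, hw z hz x, hw' z hz x, add_zero]
      neg_mem' := fun {w} hw z hz x => by rw [mul_neg, hw z hz x, neg_zero] }
  have hI : IsGradedTwoSidedIdeal F 𝒜 I := by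
    refine ⟨fun z hz c => ⟨fun x => ?_, fun x => ?_⟩, hIg⟩
    · rw [mul_assoc z]
      exact hz _
    · rw [mul_assoc c, mul_assoc c, hz x, mul_zero]
  have hJ : IsGradedTwoSidedIdeal F 𝒜 J := by
    refine ⟨fun w hw c => ⟨fun z hz x => ?_, fun z hz x => ?_⟩, ?_⟩
    · rw [← mul_assoc, hw z hz x, zero_mul]
    · rw [← mul_assoc, mul_assoc z]
      exact hw z hz _
    · intro w hw k z hz x
      have hzx : z * x * w = 0 := hw z hz x
      have key : ∀ (l m : ZMod 2) (y : A), y ∈ 𝒜 m →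
          ((DirectSum.decompose 𝒜 z l : 𝒜 l) : A) * y * (DirectSum.decompose 𝒜 w k : 𝒜 k) = 0 :=
        fun l m y hy => mul_component_eq_zero
          (SetLike.mul_mem_graded (DirectSum.decompose 𝒜 z l).2 hy) (hw _ (hIg z hz l) y) k
      have key2 : ∀ l : ZMod 2,
          ((DirectSum.decompose 𝒜 z l : 𝒜 l) : A) * x * (DirectSum.decompose 𝒜 w k : 𝒜 k) = 0 := by
        intro l
        clear hzx
        induction x using DirectSum.Decomposition.inductionOn 𝒜 with
        | zero => simp
        | homogeneous m => exact key l _ _ m.2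
        | add m n hm hn => rw [mul_add, add_mul, hm, hn, add_zero]
      classical
      rw [← DirectSum.sum_support_decompose 𝒜 z, Finset.sum_mul, Finset.sum_mul]
      exact Finset.sum_eq_zero fun l _ => key2 l
  have haI : a ∈ I := hab
  have hbJ : b ∈ J := fun z hz x => hz x
  obtain ⟨x, hx, y, hy, hxy⟩ := hprime I J hI hJ
    (fun h => ha0 (by rw [h] at haI; exact AddSubgroup.mem_bot.mp haI))
    (fun h => hb0 (by rw [h] at hbJ; exact AddSubgroup.mem_bot.mp hbJ))
  exact hxy (by simpa using hy x hx 1)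

theorem exists_inv_of_isPrimitiveIdem {e : A} (he : IsPrimitiveIdem F 𝒜 e) {i : ZMod 2}
    {x : A} (hx : x ∈ 𝒜 i) (hx0 : x ≠ 0) (hex : e * x = x) (hxe : x * e = x) :
    ∃ y ∈ 𝒜 i, e * y = y ∧ y * e = y ∧ x * y = e ∧ y * x = e := by
  obtain ⟨he0, hee, -, hinv⟩ := he
  obtain ⟨Y, h1, h2⟩ := hinv i x hx (by rwa [hex, hxe])
  rw [hex, hxe] at h1 h2
  set W := e * Y * e with hW
  have heW : e * W = W := by rw [hW, ← mul_assoc, ← mul_assoc, hee]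
  have hWe : W * e = W := by rw [hW, mul_assoc, hee]
  have hec : ∀ k, k = 0 → ((DirectSum.decompose 𝒜 e k : 𝒜 k) : A) = e := by
    rintro k rfl
    exact DirectSum.decompose_of_mem_same 𝒜 he0
  refine ⟨(DirectSum.decompose 𝒜 W i : 𝒜 i), SetLike.coe_mem _, ?_, ?_, ?_, ?_⟩
  · have h := DirectSum.coe_decompose_mul_add_of_left_mem 𝒜 (j := i) (b := W) he0
    rw [heW] at h
    rw [← h, zero_add]
  · have h := DirectSum.coe_decompose_mul_add_of_right_mem 𝒜 (i := i) (a := W) he0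
    rw [hWe] at h
    rw [← h, add_zero]
  · rw [← DirectSum.coe_decompose_mul_add_of_left_mem 𝒜 hx, h1, hec _ (add_self_zmod_two i)]
  · rw [← DirectSum.coe_decompose_mul_add_of_right_mem 𝒜 hx, h2, hec _ (add_self_zmod_two i)]

theorem isPrimitiveIdem_of_exists_inv {e : A} (he0 : e ∈ 𝒜 0) (hee : e * e = e) (hne : e ≠ 0)
    (h : ∀ (i : ZMod 2) (x : A), x ∈ 𝒜 i → x ≠ 0 → e * x = x → x * e = x →
      ∃ y, x * y = e ∧ y * x = e) : IsPrimitiveIdem F 𝒜 e := by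
  refine ⟨he0, hee, hne, fun i x hx hx0 => ?_⟩
  have h1 : e * (e * x * e) = e * x * e := by rw [← mul_assoc, ← mul_assoc, hee]
  have h2 : e * x * e * e = e * x * e := by rw [mul_assoc, hee]
  obtain ⟨y, hy1, hy2⟩ := h i (e * x * e) (mul_even_mem (even_mul_mem he0 hx) he0) hx0 h1 h2
  refine ⟨y, ?_, ?_⟩
  · rw [← mul_assoc, ← mul_assoc, h2, hy1, hee]
  · rw [mul_assoc _ e (e * x * e), h1, mul_assoc, hy2, hee]

theorem isPrimitiveIdem_mul_swap {e p q : A} (he : IsPrimitiveIdem F 𝒜 e) {i : ZMod 2}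
    (hp : p ∈ 𝒜 i) (hq : q ∈ 𝒜 i) (hep : e * p = p) (hqe : q * e = q) (hpq : p * q = e) :
    IsPrimitiveIdem F 𝒜 (q * p) := by
  have hidem : q * p * (q * p) = q * p := by
    rw [mul_assoc, ← mul_assoc p, hpq, hep]
  refine isPrimitiveIdem_of_exists_inv (mem_mul_self hq hp) hidem ?_ ?_
  · intro h
    apply he.2.2.1
    calc e = p * (q * p) * q := by rw [← mul_assoc, hpq, hep, hpq]
      _ = 0 := by rw [h]; simp
  · intro k x hx hx0 h1 h2
    have hw : x = q * (p * x * q) * p := by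
      calc x = q * p * x * (q * p) := by rw [h1, h2]
        _ = _ := by noncomm_ring
    obtain ⟨z, -, hez, hze, hwz, hzw⟩ := exists_inv_of_isPrimitiveIdem he
      (SetLike.mul_mem_graded (SetLike.mul_mem_graded hp hx) hq)
      (fun h => hx0 (by rw [hw, h]; simp))
      (by rw [← mul_assoc, ← mul_assoc, hep]) (by rw [mul_assoc, hqe])
    refine ⟨q * z * p, ?_, ?_⟩
    · calc x * (q * z * p) = q * (p * x * q) * (p * q) * z * p := by
            nth_rewrite 1 [hw]; noncomm_ring
        _ = q * ((p * x * q) * (e * z)) * p := by rw [hpq]; noncomm_ring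
        _ = q * p := by rw [hez, hwz, hqe]
    · calc q * z * p * x = q * z * (p * q) * (p * x * q) * p := by
            nth_rewrite 1 [hw]; noncomm_ring
        _ = q * ((z * e) * (p * x * q)) * p := by rw [hpq]; noncomm_ring
        _ = q * p := by rw [hze, hzw, hqe]

theorem exists_dual (hprime : SuperPrime F 𝒜) {e f : A} (he : IsPrimitiveIdem F 𝒜 e)
    (hf : IsPrimitiveIdem F 𝒜 f) {i : ZMod 2} {u : A} (hu : u ∈ 𝒜 i) (hu0 : u ≠ 0)
    (heu : e * u = u) (huf : u * f = u) :
    ∃ v ∈ 𝒜 i, f * v = v ∧ v * e = v ∧ u * v = e ∧ v * u = f := by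
  obtain ⟨k, x, hx, hne⟩ := exists_mul_mul_ne_zero hprime he.1 hu0 he.2.2.1
  obtain ⟨z, hz, hez, hze, hwz, -⟩ := exists_inv_of_isPrimitiveIdem he
    (mul_even_mem (SetLike.mul_mem_graded hu hx) he.1) hne
    (by rw [← mul_assoc, ← mul_assoc, heu]) (by rw [mul_assoc, he.2.1])
  have hv : f * x * e * z ∈ 𝒜 i := by
    have h := SetLike.mul_mem_graded (mul_even_mem (even_mul_mem hf.1 hx) he.1) hz
    rwa [add_left_comm, add_self_zmod_two, add_zero] at h
  have hfv : f * (f * x * e * z) = f * x * e * z := by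
    simp only [← mul_assoc, hf.2.1]
  have hve : f * x * e * z * e = f * x * e * z := by rw [mul_assoc, hze]
  have huv : u * (f * x * e * z) = e := by
    simp only [← mul_assoc, huf]
    exact hwz
  generalize f * x * e * z = v at hv hfv hve huv
  refine ⟨v, hv, hfv, hve, huv, ?_⟩
  have hpp : v * u * (v * u) = v * u := by
    rw [mul_assoc, ← mul_assoc u, huv, heu]
  have hpf : v * u * f = v * u := by rw [mul_assoc, huf]
  obtain ⟨y, -, -, -, hpy, -⟩ := exists_inv_of_isPrimitiveIdem hf (mem_mul_self hv hu)
    (fun h => hu0 (by rw [← heu, ← huv, mul_assoc, h, mul_zero]))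
    (by rw [← mul_assoc, hfv]) hpf
  calc v * u = v * u * f := hpf.symm
    _ = v * u * (v * u) * y := by rw [← hpy]; noncomm_ring
    _ = f := by rw [hpp, hpy]

theorem exists_isPrimitiveIdem (hprime : SuperPrime F 𝒜) {I : AddSubgroup A}
    (hI : IsMinimalGradedRightIdeal F 𝒜 I) : ∃ e, IsPrimitiveIdem F 𝒜 e := by
  obtain ⟨⟨hIr, hIg⟩, hI0, hImin⟩ := hI
  have hex : ∃ i, ∃ a ∈ 𝒜 i, a ∈ I ∧ a ≠ 0 := by
    by_contra! h
    refine hI0 ((AddSubgroup.eq_bot_iff_forall _).2 fun x hx => ?_)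
    exact eq_zero_of_components 𝒜 fun i => h i _ (SetLike.coe_mem _) (hIg x hx i)
  have hmul : ∀ (i : ZMod 2) (b : A), b ∈ 𝒜 i → b ∈ I →
      (∃ c ∈ I, b * c ≠ 0) → ∀ z ∈ I, ∃ c ∈ I, b * c = z := by
    rintro i b hb hbI ⟨c, hc, hbc⟩ z hz
    have hJ : IsGradedRightIdeal F 𝒜 (I.map (AddMonoidHom.mulLeft b)) := by
      refine ⟨?_, ?_⟩
      · rintro _ ⟨x, hx, rfl⟩ a
        exact ⟨x * a, hIr x hx a, by simp [mul_assoc]⟩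
      · rintro _ ⟨x, hx, rfl⟩ k
        refine ⟨_, hIg x hx (k - i), ?_⟩
        have h := DirectSum.coe_decompose_mul_add_of_left_mem 𝒜 (j := k - i) (b := x) hb
        rw [add_sub_cancel] at h
        exact h.symm
    have hle : I.map (AddMonoidHom.mulLeft b) ≤ I := by
      rintro _ ⟨x, hx, rfl⟩
      exact hIr b hbI x
    rcases hImin _ hJ hle with h | h
    · exact absurd ((AddSubgroup.eq_bot_iff_forall _).1 h _ ⟨c, hc, rfl⟩) hbc
    · rw [← h] at hz
      obtain ⟨x, hx, hxz⟩ := hz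
      exact ⟨x, hx, hxz⟩
  obtain ⟨i, a, ha, haI, ha0⟩ := hex
  obtain ⟨k, x, hx, hne⟩ := exists_mul_mul_ne_zero hprime ha ha0 ha0
  have hb := SetLike.mul_mem_graded ha hx
  have hbI := hIr a haI x
  generalize a * x = b at hb hbI hne
  obtain ⟨c, hcI, hbc⟩ := hmul _ b hb hbI ⟨a, haI, hne⟩ b hbI
  have hbe : b * (DirectSum.decompose 𝒜 c 0 : 𝒜 0) = b := by
    have h := DirectSum.coe_decompose_mul_add_of_left_mem 𝒜 (j := 0) (b := c) hb
    rw [hbc, add_zero, DirectSum.decompose_of_mem_same 𝒜 hb] at h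
    exact h.symm
  have he0 : ((DirectSum.decompose 𝒜 c 0 : 𝒜 0) : A) ∈ 𝒜 0 := SetLike.coe_mem _
  have heI := hIg c hcI 0
  generalize ((DirectSum.decompose 𝒜 c 0 : 𝒜 0) : A) = e at hbe he0 heI
  have hb0 : b ≠ 0 := fun h => hne (by rw [h, zero_mul])
  have hne : e ≠ 0 := fun h => hb0 (by rw [← hbe, h, mul_zero])
  have hker : ∀ y ∈ I, b * y = 0 → y = 0 := by
    let K : AddSubgroup A := I ⊓ (AddMonoidHom.mulLeft b).ker
    have hK : IsGradedRightIdeal F 𝒜 K := by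
      refine ⟨fun x hx a => ⟨hIr x hx.1 a, ?_⟩, fun x hx k => ⟨hIg x hx.1 k, ?_⟩⟩
      · have h : b * x = 0 := hx.2
        change b * (x * a) = 0
        rw [← mul_assoc, h, zero_mul]
      · exact mul_component_eq_zero hb hx.2 k
    rcases hImin K hK inf_le_left with h | h
    · exact fun y hy hby => (AddSubgroup.eq_bot_iff_forall _).1 h y ⟨hy, hby⟩
    · rw [← h] at heI
      have h' : b * e = 0 := heI.2
      exact absurd (hbe ▸ h') hb0
  have hee : e * e = e := by
    rw [← sub_eq_zero]
    refine hker _ (I.sub_mem (hIr e heI e) heI) ?_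
    rw [mul_sub, ← mul_assoc, hbe, hbe, sub_self]
  have hright : ∀ (i : ZMod 2) (x : A), x ∈ 𝒜 i → x ≠ 0 → e * x = x → x * e = x →
      ∃ y ∈ 𝒜 i, y ≠ 0 ∧ e * y = y ∧ y * e = y ∧ x * y = e := by
    intro i x hx hx0 hex hxe
    obtain ⟨c, hcI, hxc⟩ := hmul i x hx (by rw [← hex]; exact hIr e heI x)
      ⟨e, heI, by rwa [hxe]⟩ e heI
    have hxy : x * (e * (DirectSum.decompose 𝒜 c i : 𝒜 i) * e) = e := by
      have h := DirectSum.coe_decompose_mul_add_of_left_mem 𝒜 (j := i) (b := c) hx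
      have hec : ∀ k, k = 0 → ((DirectSum.decompose 𝒜 e k : 𝒜 k) : A) = e := by
        rintro k rfl
        exact DirectSum.decompose_of_mem_same 𝒜 he0
      rw [hxc, hec _ (add_self_zmod_two i)] at h
      rw [← mul_assoc, ← mul_assoc, hxe, ← h, hee]
    refine ⟨_, mul_even_mem (even_mul_mem he0 (SetLike.coe_mem _)) he0, ?_, ?_, ?_, hxy⟩
    · exact fun h => hne (by rw [← hxy, h, mul_zero])
    · rw [← mul_assoc, ← mul_assoc, hee]
    · rw [mul_assoc, hee]
  refine ⟨e, isPrimitiveIdem_of_exists_inv he0 hee hne fun i x hx hx0 hex hxe => ?_⟩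
  obtain ⟨y, hy, hy0, hey, hye, hxy⟩ := hright i x hx hx0 hex hxe
  obtain ⟨z, -, -, hez, -, hyz⟩ := hright i y hy hy0 hey hye
  have hzx : z = x := by
    rw [← hez, ← hxy, mul_assoc, hyz, hxe]
  exact ⟨y, hxy, hzx ▸ hyz⟩

end Graded

section Involution

variable {F : Type*} {A : Type*} [Field F] [Ring A] [Algebra F A]
variable {𝒜 : ZMod 2 → Submodule F A} {σ : A ≃+ A}

theorem map_even_mul (hσ : IsAddSuperInvolution F 𝒜 σ) {j : ZMod 2} {x y : A}
    (hx : x ∈ 𝒜 0) (hy : y ∈ 𝒜 j) : σ (x * y) = σ y * σ x := by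
  simpa using hσ.2.1 0 j x hx y hy

theorem map_mul_even (hσ : IsAddSuperInvolution F 𝒜 σ) {i : ZMod 2} {x y : A}
    (hx : x ∈ 𝒜 i) (hy : y ∈ 𝒜 0) : σ (x * y) = σ y * σ x := by
  simpa using hσ.2.1 i 0 x hx y hy

theorem map_odd_mul_odd (hσ : IsAddSuperInvolution F 𝒜 σ) {x y : A}
    (hx : x ∈ 𝒜 1) (hy : y ∈ 𝒜 1) : σ (x * y) = -(σ y * σ x) := by
  have h := hσ.2.1 1 1 x hx y hy
  have h1 : ((1 : ZMod 2).val) = 1 := rfl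
  rw [h1] at h
  simpa using h

theorem mul_add_map_mul_eq_zero {e : A} {i : ZMod 2} {x y : A}
    (hx : x ∈ 𝒜 i) (hy : y ∈ 𝒜 i) (hex : e * x = x) (hey : e * y = y)
    (hiso : ∀ z ∈ 𝒜 i, e * z = z → z * σ z = 0) : x * σ y + y * σ x = 0 := by
  have h := hiso (x + y) (Submodule.add_mem _ hx hy) (by rw [mul_add, hex, hey])
  rw [map_add, add_mul, mul_add, mul_add, hiso x hx hex, hiso y hy hey] at h
  simpa using h

theorem caseIII_of_odd_fixed (hσ : IsAddSuperInvolution F 𝒜 σ)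
    {e u v : A} (he : IsPrimitiveIdem F 𝒜 e) (hcorner : ∀ x ∈ 𝒜 0, e * x * σ e = 0)
    (hu : u ∈ 𝒜 1) (hv : v ∈ 𝒜 1) (heu : e * u = u) (huf : u * σ e = u) (hfv : σ e * v = v)
    (hve : v * e = v) (huv : u * v = e) (hvu : v * u = σ e) (hsu : σ u = u) :
    CaseIII F 𝒜 σ := by
  refine ⟨⟨e, he, hcorner⟩, e, he, hcorner, u, v, ⟨u, hu, by rw [heu, huf]⟩,
    ⟨v, hv, by rw [hfv, hve]⟩, hsu, ?_, huv, hvu⟩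
  have hsv := map_odd_mul_odd hσ hu hv
  rw [huv, hsu, ← neg_mul] at hsv
  have hsve : σ v * e = σ v := by
    have h := map_even_mul hσ (hσ.1 0 e he.1) hv
    rwa [hfv, hσ.2.2, eq_comm] at h
  exact neg_eq_iff_eq_neg.mp (eq_of_mul_eq hsv.symm (by rw [neg_mul, hsve]) huv hfv)

/-- If homogeneous elements of `eA` are isotropic, the even part of `eAe*` is skew. -/
theorem map_eq_neg_of_isotropic (hσ : IsAddSuperInvolution F 𝒜 σ) {e : A}
    (he : IsPrimitiveIdem F 𝒜 e) (hiso : ∀ z ∈ 𝒜 0, e * z = z → z * σ z = 0) {w : A}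
    (hw : w ∈ 𝒜 0) (hew : e * w = w) (hwf : w * σ e = w) : σ w = -w := by
  have h := mul_add_map_mul_eq_zero hw he.1 hew he.2.1 hiso
  have hesw : e * σ w = σ w := by
    have h := map_mul_even hσ hw (hσ.1 0 e he.1)
    rwa [hwf, hσ.2.2, eq_comm] at h
  rw [hwf, hesw] at h
  exact eq_neg_of_add_eq_zero_right h

variable [GradedAlgebra 𝒜]

theorem map_corner (hσ : IsAddSuperInvolution F 𝒜 σ) {i : ZMod 2} {e x f : A}
    (he : e ∈ 𝒜 0) (hx : x ∈ 𝒜 i) (hf : f ∈ 𝒜 0) :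
    σ (e * x * f) = σ f * σ x * σ e := by
  rw [map_mul_even hσ (even_mul_mem he hx) hf, map_even_mul hσ he hx, mul_assoc]

theorem isPrimitiveIdem_map (hσ : IsAddSuperInvolution F 𝒜 σ) {e : A}
    (he : IsPrimitiveIdem F 𝒜 e) : IsPrimitiveIdem F 𝒜 (σ e) := by
  have hff : σ e * σ e = σ e := by
    rw [← map_even_mul hσ he.1 he.1, he.2.1]
  have hf0 := hσ.1 0 e he.1
  refine isPrimitiveIdem_of_exists_inv hf0 hff
    (fun h => he.2.2.1 (σ.map_eq_zero_iff.mp h)) fun i x hx hx0 h1 h2 => ?_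
  have hx' := hσ.1 i x hx
  have h1' : σ x * e = σ x := by
    have h := map_even_mul hσ hf0 hx
    rwa [h1, hσ.2.2, eq_comm] at h
  have h2' : e * σ x = σ x := by
    have h := map_mul_even hσ hx hf0
    rwa [h2, hσ.2.2, eq_comm] at h
  obtain ⟨y, hy, -, -, hxy, hyx⟩ := exists_inv_of_isPrimitiveIdem he hx'
    (fun h => hx0 (σ.map_eq_zero_iff.mp h)) h2' h1'
  rcases zmod_two_cases i with rfl | rfl
  · have ha := map_even_mul hσ hx' hy
    have hb := map_even_mul hσ hy hx'
    rw [hσ.2.2, hxy] at ha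
    rw [hσ.2.2, hyx] at hb
    exact ⟨σ y, hb.symm, ha.symm⟩
  · have ha := map_odd_mul_odd hσ hx' hy
    have hb := map_odd_mul_odd hσ hy hx'
    rw [hσ.2.2, hxy] at ha
    rw [hσ.2.2, hyx] at hb
    exact ⟨-σ y, by rw [mul_neg, hb], by rw [neg_mul, ha]⟩

/-- An anisotropic homogeneous element of `eA` yields a symmetric primitive idempotent. -/
theorem caseI_of_mul_map_ne_zero (hprime : SuperPrime F 𝒜) (hσ : IsAddSuperInvolution F 𝒜 σ)
    {e : A} (he : IsPrimitiveIdem F 𝒜 e) {i : ZMod 2} {x : A} (hx : x ∈ 𝒜 i)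
    (hex : e * x = x) (hne : x * σ x ≠ 0) : CaseI F 𝒜 σ := by
  have hx' := hσ.1 i x hx
  have hf := isPrimitiveIdem_map hσ he
  have hxf : σ x * σ e = σ x := by rw [← map_even_mul hσ he.1 hx, hex]
  have hu := mem_mul_self hx hx'
  obtain ⟨v, hv, hfv, hve, huv, hvu⟩ := exists_dual hprime he hf
    hu hne (by rw [← mul_assoc, hex]) (by rw [mul_assoc, hxf])
  refine ⟨σ x * v * x, isPrimitiveIdem_mul_swap he hx (mul_even_mem hx' hv) hex
    (by rw [mul_assoc, hve]) (by rw [← mul_assoc, huv]), ?_⟩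
  have hvx := even_mul_mem hv hx
  have hsve : σ v * e = σ v := by
    have h := map_even_mul hσ hf.1 hv
    rwa [hfv, hσ.2.2, eq_comm] at h
  have hsv := map_even_mul hσ hu hv
  rw [huv] at hsv
  rcases zmod_two_cases i with rfl | rfl
  · rw [map_even_mul hσ hx hx', hσ.2.2] at hsv
    have hvv := eq_of_mul_eq hsv.symm hsve huv hfv
    rw [mul_assoc, map_even_mul hσ hx' hvx, map_even_mul hσ hv hx, hσ.2.2, hvv, mul_assoc]
  · rw [map_odd_mul_odd hσ hx hx', hσ.2.2, mul_neg, ← neg_mul] at hsv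
    have hvv := eq_of_mul_eq hsv.symm (by rw [neg_mul, hsve]) huv hfv
    rw [mul_assoc, map_odd_mul_odd hσ hx' hvx, map_even_mul hσ hv hx, hσ.2.2,
      ← neg_mul, ← mul_neg, hvv, mul_assoc]

theorem caseIII_of_corner (hprime : SuperPrime F 𝒜)
    (hσ : IsAddSuperInvolution F 𝒜 σ) {e : A} (he : IsPrimitiveIdem F 𝒜 e)
    (hcorner : ∀ x ∈ 𝒜 0, e * x * σ e = 0) : CaseIII F 𝒜 σ := by
  have hf := isPrimitiveIdem_map hσ he
  obtain ⟨k, x, hx, hne⟩ := exists_mul_mul_ne_zero hprime hf.1 he.2.2.1 hf.2.2.1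
  obtain rfl : k = 1 := (zmod_two_cases k).resolve_left
    (fun h => hne (hcorner x (h ▸ hx)))
  have hy := mul_even_mem (even_mul_mem he.1 hx) hf.1
  have hey : e * (e * x * σ e) = e * x * σ e := by
    rw [← mul_assoc, ← mul_assoc, he.2.1]
  have hyf : e * x * σ e * σ e = e * x * σ e := by rw [mul_assoc, hf.2.1]
  generalize e * x * σ e = y at hne hy hey hyf
  have hsy := hσ.1 1 y hy
  have hesy : e * σ y = σ y := by
    have h := map_mul_even hσ hy hf.1
    rwa [hyf, hσ.2.2, eq_comm] at h
  have hsyf : σ y * σ e = σ y := by rw [← map_even_mul hσ he.1 hy, hey]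
  by_cases h : y + σ y = 0
  · have hsy : σ y = -y := eq_neg_of_add_eq_zero_right h
    obtain ⟨v, hv, hfv, hve, hyv, hvy⟩ := exists_dual hprime he hf hy hne hey hyf
    have hsv := map_odd_mul_odd hσ hy hv
    rw [hyv, hsy, mul_neg, neg_neg] at hsv
    have hsve : σ v * e = σ v := by
      have h := map_even_mul hσ hf.1 hv
      rwa [hfv, hσ.2.2, eq_comm] at h
    refine caseIII_of_odd_fixed hσ (u := v) (v := y) hf ?_ hv hy hfv ?_ ?_ hyf hvy ?_
      (eq_of_mul_eq hsv.symm hsve hyv hfv)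
    · intro w hw
      rw [hσ.2.2]
      by_contra hw0
      obtain ⟨t, ht, het, htf, -, htw⟩ := exists_dual hprime hf he
        (mul_even_mem (even_mul_mem hf.1 hw) he.1) hw0
        (by rw [← mul_assoc, ← mul_assoc, hf.2.1]) (by rw [mul_assoc, he.2.1])
      have := hcorner t ht
      rw [het, htf] at this
      exact he.2.2.1 (by rw [← htw, this, zero_mul])
    · rw [hσ.2.2, hve]
    · rw [hσ.2.2, hey]
    · rw [hσ.2.2, hyv]
  · obtain ⟨v, hv, hfv, hve, huv, hvu⟩ := exists_dual hprime he hf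
      (Submodule.add_mem _ hy hsy) h (by rw [mul_add, hey, hesy]) (by rw [add_mul, hyf, hsyf])
    exact caseIII_of_odd_fixed hσ he hcorner (Submodule.add_mem _ hy hsy) hv
      (by rw [mul_add, hey, hesy]) (by rw [add_mul, hyf, hsyf]) hfv hve huv hvu
      (by rw [map_add, hσ.2.2, add_comm])

theorem odd_eq_zero_of_isotropic (hchar : (2 : F) ≠ 0) (hprime : SuperPrime F 𝒜)
    (hσ : IsAddSuperInvolution F 𝒜 σ) {e : A} (he : IsPrimitiveIdem F 𝒜 e)
    (hiso : ∀ i, ∀ z ∈ 𝒜 i, e * z = z → z * σ z = 0)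
    (hodd : ∀ x ∈ 𝒜 1, e * x * σ e = 0) : ∀ x ∈ 𝒜 1, x = 0 := by
  have hf := isPrimitiveIdem_map hσ he
  have heven : ∀ x ∈ 𝒜 1, e * x = x → x = 0 := by
    intro x hx hex
    by_contra hx0
    have hsx := hσ.1 1 x hx
    have hxf : σ x * σ e = σ x := by rw [← map_even_mul hσ he.1 hx, hex]
    obtain ⟨k, b, hb, hne⟩ := exists_mul_mul_ne_zero hprime hsx hx0
      (fun h => hx0 (σ.map_eq_zero_iff.mp h))
    have hecorner : e * (x * b * σ x) * σ e = x * b * σ x := by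
      rw [mul_assoc, mul_assoc (x * b), hxf, ← mul_assoc, ← mul_assoc, hex]
    rcases zmod_two_cases k with rfl | rfl
    · have hxb := mul_even_mem hx hb
      have hw : x * b * σ x ∈ 𝒜 0 := mem_mul_self hxb hsx
      have h1 := mul_add_map_mul_eq_zero hx hxb hex
        (by rw [← mul_assoc, hex]) (hiso 1)
      rw [map_mul_even hσ hx hb, ← mul_assoc] at h1
      have h2 := map_eq_neg_of_isotropic hσ he (hiso 0) hw
        (by rw [← mul_assoc, ← mul_assoc, hex]) (by rw [mul_assoc, hxf])
      rw [map_odd_mul_odd hσ hxb hsx, map_mul_even hσ hx hb, hσ.2.2, neg_inj,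
        ← mul_assoc] at h2
      rw [h2] at h1
      exact hne (eq_zero_of_eq_neg hchar (eq_neg_of_add_eq_zero_right h1))
    · refine hne (hecorner ▸ hodd _ ?_)
      have h := SetLike.mul_mem_graded (mem_mul_self hx hb) hsx
      rwa [zero_add] at h
  intro a ha
  by_contra ha0
  obtain ⟨k, x, hx, hne⟩ := exists_mul_mul_ne_zero hprime ha he.2.2.1 ha0
  rcases zmod_two_cases k with rfl | rfl
  · exact hne (heven _ (even_mul_mem (even_mul_mem he.1 hx) ha)
      (by rw [← mul_assoc, ← mul_assoc, he.2.1]))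
  · refine hne ?_
    rw [heven (e * x) (even_mul_mem he.1 hx) (by rw [← mul_assoc, he.2.1]), zero_mul]

theorem caseII_of_isotropic (hchar : (2 : F) ≠ 0) (hprime : SuperPrime F 𝒜)
    (hσ : IsAddSuperInvolution F 𝒜 σ) {e c : A} (he : IsPrimitiveIdem F 𝒜 e)
    (hiso : ∀ i, ∀ z ∈ 𝒜 i, e * z = z → z * σ z = 0) (hc : c ∈ 𝒜 0)
    (hne : e * c * σ e ≠ 0) : CaseII F 𝒜 σ := by
  have hf := isPrimitiveIdem_map hσ he
  have hskew : ∀ w ∈ 𝒜 0, e * w = w → w * σ e = w → σ w = -w :=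
    fun w hw h1 h2 => map_eq_neg_of_isotropic hσ he (hiso 0) hw h1 h2
  have hu := mul_even_mem (even_mul_mem he.1 hc) hf.1
  have heu : e * (e * c * σ e) = e * c * σ e := by
    rw [← mul_assoc, ← mul_assoc, he.2.1]
  have huf : e * c * σ e * σ e = e * c * σ e := by rw [mul_assoc, hf.2.1]
  generalize e * c * σ e = u at hne hu heu huf
  have hsu := hskew u hu heu huf
  obtain ⟨v, hv, hfv, hve, huv, hvu⟩ := exists_dual hprime he hf hu hne heu huf
  have hsv : σ v = -v := by
    have h := map_even_mul hσ hu hv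
    rw [huv, hsu, mul_neg, ← neg_mul] at h
    have hsve : σ v * e = σ v := by
      have h := map_even_mul hσ hf.1 hv
      rwa [hfv, hσ.2.2, eq_comm] at h
    exact neg_eq_iff_eq_neg.mp (eq_of_mul_eq h.symm (by rw [neg_mul, hsve]) huv hfv)
  have heven : ∀ a ∈ 𝒜 0, e * a = a → a * e = a → σ a = v * a * u := by
    intro a ha hea hae
    have h := hskew (a * u) (mul_even_mem ha hu) (by rw [← mul_assoc, hea])
      (by rw [mul_assoc, huf])
    rw [map_even_mul hσ ha hu, hsu, neg_mul, neg_inj] at h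
    have hfa : σ e * σ a = σ a := by rw [← map_mul_even hσ ha he.1, hae]
    rw [← hfa, ← hvu, mul_assoc, h, mul_assoc]
  have hcomm : ∀ a ∈ 𝒜 0, ∀ b ∈ 𝒜 0, e * a = a → a * e = a → e * b = b → b * e = b →
      a * b = b * a := by
    intro a ha b hb hea hae heb hbe
    have h := heven (a * b) (mul_even_mem ha hb) (by rw [← mul_assoc, hea])
      (by rw [mul_assoc, hbe])
    rw [map_even_mul hσ ha hb, heven a ha hea hae, heven b hb heb hbe] at h
    calc a * b = e * (a * b) * e := by rw [← mul_assoc, hea, mul_assoc, hbe]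
      _ = u * (v * (a * b) * u) * v := by rw [← huv]; noncomm_ring
      _ = (u * v) * b * (u * v) * a * (u * v) := by rw [← h]; noncomm_ring
      _ = b * a := by rw [huv, heb, hbe, mul_assoc, hae]
  have hD1 : ∀ d ∈ 𝒜 1, e * d = d → d * e = d → d = 0 := by
    have hfix : ∀ d ∈ 𝒜 1, e * d = d → d * e = d →
        (u * σ d * v = d ∨ u * σ d * v = -d) → d = 0 := by
      intro d hd hed hde h
      by_contra hd0
      obtain ⟨y, -, -, -, hdy, -⟩ := exists_inv_of_isPrimitiveIdem he hd hd0 hed hde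
      have h2 := heven (d * d) (mem_mul_self hd hd) (by rw [← mul_assoc, hed])
        (by rw [mul_assoc, hde])
      have hsde : σ d * σ e = σ d := by rw [← map_even_mul hσ he.1 hd, hed]
      have h3 : d * d = -(u * σ d * v * (u * σ d * v)) := by
        calc d * d = e * (d * d) * e := by rw [← mul_assoc, hed, mul_assoc, hde]
          _ = u * (v * (d * d) * u) * v := by rw [← huv]; noncomm_ring
          _ = -(u * (σ d * σ d) * v) := by
            rw [← h2, map_odd_mul_odd hσ hd hd]; noncomm_ring
          _ = -(u * (σ d * σ e * σ d) * v) := by rw [hsde]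
          _ = _ := by rw [← hvu]; noncomm_ring
      have h4 : d * d = 0 := by
        rcases h with h | h
        · rw [h] at h3
          exact eq_zero_of_eq_neg hchar h3
        · rw [h, neg_mul_neg] at h3
          exact eq_zero_of_eq_neg hchar h3
      apply hd0
      rw [← hde, ← hdy, ← mul_assoc, h4, zero_mul]
    intro d hd hed hde
    have hτ : u * σ d * v ∈ 𝒜 1 := mul_even_mem (even_mul_mem hu (hσ.1 1 d hd)) hv
    have hττ : u * σ (u * σ d * v) * v = d := by
      rw [map_corner hσ hu (hσ.1 1 d hd) hv, hσ.2.2, hsu, hsv]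
      calc u * (-v * d * -u) * v = (u * v) * d * (u * v) := by noncomm_ring
        _ = d := by rw [huv, hed, hde]
    have heτ : e * (u * σ d * v) = u * σ d * v := by
      rw [← mul_assoc, ← mul_assoc, heu]
    have hτe : u * σ d * v * e = u * σ d * v := by rw [mul_assoc, hve]
    have hsum := hfix (d + u * σ d * v) (Submodule.add_mem _ hd hτ)
      (by rw [mul_add, hed, heτ]) (by rw [add_mul, hde, hτe])
      (Or.inl (by rw [map_add, mul_add, add_mul, hττ, add_comm]))
    refine hfix d hd hed hde (Or.inr (eq_neg_of_add_eq_zero_right hsum))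
  have hodd : ∀ x ∈ 𝒜 1, x = 0 := by
    refine odd_eq_zero_of_isotropic hchar hprime hσ he hiso fun x hx => ?_
    have h := hD1 (e * x * v) (mul_even_mem (even_mul_mem he.1 hx) hv)
      (by rw [← mul_assoc, ← mul_assoc, he.2.1]) (by rw [mul_assoc, hve])
    rw [← hvu, ← mul_assoc, h, zero_mul]
  have hall : ∀ x : A, x ∈ 𝒜 0 := by
    intro x
    induction x using DirectSum.Decomposition.inductionOn 𝒜 with
    | zero => exact Submodule.zero_mem _
    | @homogeneous i m =>
      rcases zmod_two_cases i with rfl | rfl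
      · exact m.2
      · rw [hodd _ m.2]
        exact Submodule.zero_mem _
    | add m n hm hn => exact Submodule.add_mem _ hm hn
  have hl : ∀ x, e * (e * x * e) = e * x * e := fun x => by
    rw [← mul_assoc, ← mul_assoc, he.2.1]
  have hr : ∀ x, e * x * e * e = e * x * e := fun x => by rw [mul_assoc, he.2.1]
  refine ⟨hodd, e, he, fun x hx => ?_,
    fun x y => hcomm _ (hall _) _ (hall _) (hl x) (hr x) (hl y) (hr y),
    u, v, ⟨u, by rw [heu, huf]⟩, ⟨v, by rw [hfv, hve]⟩, hsu, hsv, huv, hvu⟩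
  have h := hskew (e * x * σ e) (hall _) (by rw [← mul_assoc, ← mul_assoc, he.2.1])
    (by rw [mul_assoc, hf.2.1])
  rw [map_corner hσ he.1 (hall x) hf.1, hσ.2.2, hx] at h
  exact eq_zero_of_eq_neg hchar h

/-- A symmetric primitive idempotent `g` gives, for each primitive idempotent `e`, a homogeneous
`x` such that `e(xgx*)e*` does not vanish. -/
theorem exists_mul_symm_mul_map_ne_zero (hprime : SuperPrime F 𝒜)
    (hσ : IsAddSuperInvolution F 𝒜 σ) {e g : A} (he : IsPrimitiveIdem F 𝒜 e)
    (hg : IsPrimitiveIdem F 𝒜 g) (hsg : σ g = g) :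
    ∃ i, ∃ x ∈ 𝒜 i, e * (x * g * σ x) * σ e ≠ 0 := by
  obtain ⟨i, x, hx, hne⟩ := exists_mul_mul_ne_zero hprime hg.1 he.2.2.1 hg.2.2.1
  refine ⟨i, x, hx, fun h => hne ?_⟩
  have hy := mul_even_mem (even_mul_mem he.1 hx) hg.1
  obtain ⟨z, -, -, -, -, hzy⟩ := exists_dual hprime he hg hy hne
    (by rw [← mul_assoc, ← mul_assoc, he.2.1]) (by rw [mul_assoc, hg.2.1])
  have hsy : σ (e * x * g) = g * σ x * σ e := by rw [map_corner hσ he.1 hx hg.1, hsg]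
  have h0 : g * σ x * σ e = 0 := by
    calc g * σ x * σ e = g * g * σ x * σ e := by rw [hg.2.1]
      _ = z * (e * x * g) * g * σ x * σ e := by rw [hzy]
      _ = z * (e * (x * (g * g) * σ x) * σ e) := by noncomm_ring
      _ = 0 := by rw [hg.2.1, h, mul_zero]
  rw [← hsy] at h0
  exact σ.map_eq_zero_iff.mp h0

end Involution

end SuperInvolution

/-- For a prime superalgebra with a minimal graded right ideal and a superinvolution,
exactly one of the three cases (i), (ii), (iii) occurs. -/
theorem prime_superalgebra_superinvolution_trichotomy
    (F : Type*) {A : Type*} [Field F] [Ring A] [Algebra F A]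
    (hchar : (2 : F) ≠ 0)
    (𝒜 : ZMod 2 → Submodule F A) [GradedAlgebra 𝒜]
    (hprime : SuperPrime F 𝒜)
    (hmin : ∃ I : AddSubgroup A, IsMinimalGradedRightIdeal F 𝒜 I)
    (σ : A ≃+ A) (hσ : IsAddSuperInvolution F 𝒜 σ) :
    (CaseI F 𝒜 σ ∨ CaseII F 𝒜 σ ∨ CaseIII F 𝒜 σ) ∧
    ¬ (CaseI F 𝒜 σ ∧ CaseII F 𝒜 σ) ∧
    ¬ (CaseI F 𝒜 σ ∧ CaseIII F 𝒜 σ) ∧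
    ¬ (CaseII F 𝒜 σ ∧ CaseIII F 𝒜 σ) := by
  open SuperInvolution in
  refine ⟨?_, ?_, ?_, ?_⟩
  · by_cases hI : CaseI F 𝒜 σ
    · exact Or.inl hI
    have hiso : ∀ e, IsPrimitiveIdem F 𝒜 e → ∀ i, ∀ z ∈ 𝒜 i, e * z = z → z * σ z = 0 :=
      fun e he i z hz hez => by_contra fun h =>
        hI (caseI_of_mul_map_ne_zero hprime hσ he hz hez h)
    obtain ⟨I, hImin⟩ := hmin
    obtain ⟨e, he⟩ := exists_isPrimitiveIdem hprime hImin
    by_cases hcorner : ∀ x ∈ 𝒜 0, e * x * σ e = 0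
    · exact Or.inr (Or.inr (caseIII_of_corner hprime hσ he hcorner))
    · push Not at hcorner
      obtain ⟨c, hc, hne⟩ := hcorner
      exact Or.inr (Or.inl (caseII_of_isotropic hchar hprime hσ he (hiso e he) hc hne))
  · rintro ⟨⟨g, hg, hsg⟩, hodd, e, he, hH, -⟩
    obtain ⟨i, x, hx, hne⟩ := exists_mul_symm_mul_map_ne_zero hprime hσ he hg hsg
    refine hne (hH _ ?_)
    rcases zmod_two_cases i with rfl | rfl
    · rw [map_corner hσ hx hg.1 (hσ.1 0 x hx), hσ.2.2, hsg]
    · rw [hodd x hx]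
      simp
  · rintro ⟨⟨g, hg, hsg⟩, ⟨e, he, hcorner⟩, -⟩
    obtain ⟨i, x, hx, hne⟩ := exists_mul_symm_mul_map_ne_zero hprime hσ he hg hsg
    exact hne (hcorner _ (mem_mul_self (mul_even_mem hx hg.1) (hσ.1 i x hx)))
  · rintro ⟨⟨hodd, -⟩, -, e, he, -, u, v, ⟨x, hx, rfl⟩, -, -, -, huv, -⟩
    apply he.2.2.1
    rw [← huv, hodd x hx]
    simp
end

section
/- Let A be a central simple superalgebra of even type over F and let η be an F-linear superantiautomorphism of A. Then there exists an invertible element a ∈ A₀ such that η²(x) = a x a⁻¹ for all x ∈ A; for any such a one has a·η(a) = η(a)·a ∈ F^×; and the square class a·η(a)·F^{×2} ∈ F^×/F^{×2} does not depend on the choice of η (and of a): if ξ is another F-linear superantiautomorphism of A with ξ²(x) = c x c⁻¹ for all x, where c ∈ A₀ is invertible, then a·η(a) and c·ξ(c) differ by a square in F^×. -/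
section Core

variable (F : Type*) {A : Type*} [Field F] [Ring A] [Algebra F A]
variable (𝒜 : ZMod 2 → Submodule F A)

/-- An F-linear superantiautomorphism. -/
def IsSuperAntiAuto (σ : A ≃ₗ[F] A) : Prop :=
  (∀ (i : ZMod 2), ∀ x ∈ 𝒜 i, σ x ∈ 𝒜 i) ∧
  ∀ (i j : ZMod 2), ∀ x ∈ 𝒜 i, ∀ y ∈ 𝒜 j,
    σ (x * y) = ((-1 : F) ^ (i.val * j.val)) • (σ y * σ x)

/-- An F-linear superinvolution. -/
def IsSuperInvolution (σ : A ≃ₗ[F] A) : Prop :=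
  IsSuperAntiAuto F 𝒜 σ ∧ ∀ x, σ (σ x) = x

/-- `σ ∘ σ` equals the grading automorphism `ν` (which is `(-1)^i` on `𝒜 i`). -/
def SquareIsGradingAuto (σ : A ≃ₗ[F] A) : Prop :=
  ∀ (i : ZMod 2), ∀ x ∈ 𝒜 i, σ (σ x) = ((-1 : F) ^ i.val) • x

/-- The graded center reduces to `F·1`. -/
def SuperCentral : Prop :=
  ∀ (i : ZMod 2), ∀ x ∈ 𝒜 i,
    (∀ (j : ZMod 2), ∀ h ∈ 𝒜 j, x * h = ((-1 : F) ^ (i.val * j.val)) • (h * x)) →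
    ∃ c : F, x = algebraMap F A c

/-- Graded simplicity: `A ≠ 0` and no proper nonzero graded two-sided ideals. -/
def SuperSimple [GradedAlgebra 𝒜] : Prop :=
  (∃ x : A, x ≠ 0) ∧
  ∀ I : TwoSidedIdeal A,
    (∀ x ∈ I, ∀ i : ZMod 2, ((DirectSum.decompose 𝒜 x i : 𝒜 i) : A) ∈ I) →
    I = ⊥ ∨ I = ⊤

/-- Odd type: the ordinary center meets the odd part nontrivially. -/
def OddType : Prop :=
  ∃ x : A, x ≠ 0 ∧ x ∈ 𝒜 1 ∧ ∀ y : A, x * y = y * x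

/-- Even type: the ordinary center meets the odd part trivially. -/
def EvenType : Prop :=
  ∀ x : A, x ∈ 𝒜 1 → (∀ y : A, x * y = y * x) → x = 0

/-- Every nonzero homogeneous element is invertible. -/
def SuperDivision : Prop :=
  ∀ (i : ZMod 2), ∀ x ∈ 𝒜 i, x ≠ 0 → IsUnit x

end Core

section CentralSimple

variable {F A : Type*} [Field F] [Ring A] [Algebra F A]

/-- A nonzero element generating a two-sided ideal as a right ideal is a unit. -/
lemma isUnit_of_forall_exists_mul_eq [IsSimpleRing A] [FiniteDimensional F A] {t : A}
    (ht : t ≠ 0) (h : ∀ x, ∃ y, x * t = t * y) : IsUnit t := by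
  have : IsNoetherianRing A := isNoetherian_of_tower F inferInstance
  let I : TwoSidedIdeal A := TwoSidedIdeal.mk' {x | ∃ y, x = t * y}
    ⟨0, by simp⟩
    (by rintro _ _ ⟨x, rfl⟩ ⟨y, rfl⟩; exact ⟨x + y, (mul_add _ _ _).symm⟩)
    (by rintro _ ⟨x, rfl⟩; exact ⟨-x, by simp⟩)
    (by
      rintro z _ ⟨x, rfl⟩
      obtain ⟨y, hy⟩ := h z
      exact ⟨y * x, by rw [← mul_assoc, hy, mul_assoc]⟩)
    (by rintro _ z ⟨x, rfl⟩; exact ⟨x * z, mul_assoc _ _ _⟩)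
  have hI : t ∈ I := by
    simp only [I, TwoSidedIdeal.mem_mk']
    exact ⟨1, (mul_one t).symm⟩
  have h1 : (1 : A) ∈ I := IsSimpleRing.one_mem_of_ne_zero_mem I ht hI
  simp only [I, TwoSidedIdeal.mem_mk'] at h1
  obtain ⟨y, hy⟩ := h1
  exact IsUnit.of_mul_eq_one y hy.symm

/-- Over a central simple algebra, a family `b` linearly independent over the base field satisfies
no nontrivial identity `∑ i, c i * y * b i = 0`. -/
lemma LinearIndependent.eq_zero_of_forall_sum_mul_mul_eq_zero [IsSimpleRing A]
    [Algebra.IsCentral F A] {ι : Type*} {b : ι → A} (hb : LinearIndependent F b)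
    (s : Finset ι) (c : ι → A) (h : ∀ y, ∑ i ∈ s, c i * y * b i = 0) : ∀ i ∈ s, c i = 0 := by
  classical
  induction s using Finset.induction_on generalizing c with
  | empty => simp
  | insert j s hj ih =>
    by_cases hcj : c j = 0
    · intro i hi
      rcases Finset.mem_insert.1 hi with rfl | hi
      · exact hcj
      · refine ih c (fun y => ?_) i hi
        have := h y
        rwa [Finset.sum_insert hj, hcj, zero_mul, zero_mul, zero_add] at this
    exfalso
    let I : TwoSidedIdeal A := TwoSidedIdeal.mk'
      {x | ∃ d : ι → A, (∀ y, ∑ i ∈ insert j s, d i * y * b i = 0) ∧ d j = x}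
      ⟨0, by simp, rfl⟩
      (by
        rintro _ _ ⟨d, hd, rfl⟩ ⟨e, he, rfl⟩
        exact ⟨d + e, fun y => by simp [add_mul, Finset.sum_add_distrib, hd, he], rfl⟩)
      (by
        rintro _ ⟨d, hd, rfl⟩
        exact ⟨-d, fun y => by simp [hd], rfl⟩)
      (by
        rintro z _ ⟨d, hd, rfl⟩
        exact ⟨fun i => z * d i, fun y => by
          simpa [mul_assoc, Finset.mul_sum] using congrArg (z * ·) (hd y), rfl⟩)
      (by
        rintro _ z ⟨d, hd, rfl⟩
        exact ⟨fun i => d i * z, fun y => by simpa [mul_assoc] using hd (z * y), rfl⟩)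
    have h1 : (1 : A) ∈ I := by
      refine IsSimpleRing.one_mem_of_ne_zero_mem I hcj ?_
      simp only [I, TwoSidedIdeal.mem_mk']
      exact ⟨c, h, rfl⟩
    simp only [I, TwoSidedIdeal.mem_mk'] at h1
    obtain ⟨d, hd, hdj⟩ := h1
    have hcomm : ∀ a, ∀ i ∈ s, a * d i - d i * a = 0 := fun a => ih _ fun y => by
      have h2 := congrArg (a * ·) (hd y)
      have h3 := hd (a * y)
      simp only [Finset.sum_insert hj, hdj, mul_add, Finset.mul_sum] at h2 h3
      simp only [sub_mul, Finset.sum_sub_distrib, mul_assoc] at h2 h3 ⊢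
      simp only [one_mul, mul_zero] at h2 h3
      exact add_left_cancel (a := a * (y * b j)) (by rw [add_sub, h2, add_zero, zero_sub,
        eq_neg_of_add_eq_zero_right h3, neg_neg])
    have hF : ∀ i ∈ insert j s, ∃ r : F, d i = algebraMap F A r := by
      intro i hi
      rcases Finset.mem_insert.1 hi with rfl | hi
      · exact ⟨1, by simp [hdj]⟩
      · exact (Algebra.IsCentral.mem_center_iff F).1
          (Subalgebra.mem_center_iff.2 fun a => sub_eq_zero.1 (hcomm a i hi))
    choose! r hr using hF
    have h0 := linearIndependent_iff'.1 hb (insert j s) r (by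
      rw [← hd 1]
      exact Finset.sum_congr rfl fun i hi => by rw [hr i hi, mul_one, Algebra.smul_def])
      j (Finset.mem_insert_self _ _)
    have := hr j (Finset.mem_insert_self _ _)
    rw [hdj, h0, map_zero] at this
    exact one_ne_zero this

/-- The **Skolem–Noether theorem** for automorphisms of a central simple algebra. -/
theorem AlgEquiv.exists_eq_conj [IsSimpleRing A] [Algebra.IsCentral F A] [FiniteDimensional F A]
    (φ : A ≃ₐ[F] A) : ∃ u : Aˣ, ∀ x, φ x = u * x * (u⁻¹ : Aˣ) := by
  let b := Module.finBasis F A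
  have hinj : ∀ c : Fin (Module.finrank F A) → A, (∀ y, ∑ i, c i * y * b i = 0) → c = 0 :=
    fun c hc => funext fun i =>
      b.linearIndependent.eq_zero_of_forall_sum_mul_mul_eq_zero Finset.univ c hc i
        (Finset.mem_univ i)
  let T : (Fin (Module.finrank F A) → A) →ₗ[F] (A →ₗ[F] A) :=
    ∑ i, LinearMap.lcomp F A (LinearMap.mulRight F (b i)) ∘ₗ LinearMap.mul F A ∘ₗ LinearMap.proj i
  have hT : ∀ c y, T c y = ∑ i, c i * y * b i := fun c y => by
    simp [T, LinearMap.sum_apply, mul_assoc]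
  have hTinj : Function.Injective T := by
    rw [← LinearMap.ker_eq_bot, LinearMap.ker_eq_bot']
    exact fun c hc => hinj c fun y => by rw [← hT, hc, LinearMap.zero_apply]
  have hTsurj : Function.Surjective T :=
    (LinearMap.injective_iff_surjective_of_finrank_eq_finrank
      (by simp [Module.finrank_linearMap, Module.finrank_pi_fintype])).1 hTinj
  obtain ⟨c, hc⟩ := hTsurj φ.toLinearMap
  have hφ : ∀ y, φ y = ∑ i, c i * y * b i := fun y => by rw [← hT, hc]; rfl
  have hcφ : ∀ x i, c i * x = φ x * c i := fun x i => by
    have := hinj (fun i => c i * x - φ x * c i) fun y => by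
      have h := map_mul φ x y
      rw [hφ (x * y), hφ y, Finset.mul_sum] at h
      simpa only [sub_mul, Finset.sum_sub_distrib, mul_assoc, sub_eq_zero] using h
    exact sub_eq_zero.1 (congrFun this i)
  obtain ⟨i, hi⟩ : ∃ i, c i ≠ 0 := by
    by_contra! h
    have := hφ 1
    simp [h] at this
  obtain ⟨u, hu⟩ := isUnit_of_forall_exists_mul_eq (F := F) hi fun x =>
    ⟨φ.symm x, by rw [hcφ, φ.apply_symm_apply]⟩
  exact ⟨u, fun x => by rw [hu, hcφ, ← hu, Units.mul_inv_cancel_right]⟩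

end CentralSimple

section Superalgebra

variable {F A : Type*} [Field F] [Ring A] [Algebra F A]

section Grading

variable (𝒜 : ZMod 2 → Submodule F A) [GradedAlgebra 𝒜]

lemma exists_even_add_odd (x : A) : ∃ y ∈ 𝒜 0, ∃ z ∈ 𝒜 1, x = y + z := by
  classical
  refine ⟨_, (DirectSum.decompose 𝒜 x 0).2, _, (DirectSum.decompose 𝒜 x 1).2, ?_⟩
  conv_lhs => rw [← DirectSum.sum_support_decompose 𝒜 x]
  rw [Finset.sum_subset (Finset.subset_univ _) fun i _ hi => by
    simpa [DFinsupp.notMem_support_iff] using hi]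
  exact Fin.sum_univ_two _

/-- The grading automorphism as a linear map. -/
def gradingLin : A →ₗ[F] A := GradedAlgebra.proj 𝒜 0 - GradedAlgebra.proj 𝒜 1

variable {𝒜}

lemma gradingLin_even {x : A} (hx : x ∈ 𝒜 0) : gradingLin 𝒜 x = x := by
  simp [gradingLin, DirectSum.decompose_of_mem_same 𝒜 hx,
    DirectSum.decompose_of_mem_ne 𝒜 hx (zero_ne_one (α := ZMod 2))]

lemma gradingLin_odd {x : A} (hx : x ∈ 𝒜 1) : gradingLin 𝒜 x = -x := by
  simp [gradingLin, DirectSum.decompose_of_mem_same 𝒜 hx,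
    DirectSum.decompose_of_mem_ne 𝒜 hx (one_ne_zero (α := ZMod 2))]

lemma even_mul_even {x y : A} (hx : x ∈ 𝒜 0) (hy : y ∈ 𝒜 0) : x * y ∈ 𝒜 0 :=
  SetLike.mul_mem_graded hx hy

lemma even_mul_odd {x y : A} (hx : x ∈ 𝒜 0) (hy : y ∈ 𝒜 1) : x * y ∈ 𝒜 1 :=
  SetLike.mul_mem_graded hx hy

lemma odd_mul_even {x y : A} (hx : x ∈ 𝒜 1) (hy : y ∈ 𝒜 0) : x * y ∈ 𝒜 1 :=
  SetLike.mul_mem_graded hx hy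

lemma odd_mul_odd {x y : A} (hx : x ∈ 𝒜 1) (hy : y ∈ 𝒜 1) : x * y ∈ 𝒜 0 :=
  SetLike.mul_mem_graded hx hy

lemma gradingLin_gradingLin (x : A) : gradingLin 𝒜 (gradingLin 𝒜 x) = x := by
  obtain ⟨y, hy, z, hz, rfl⟩ := exists_even_add_odd 𝒜 x
  simp [gradingLin_even hy, gradingLin_odd hz]

lemma gradingLin_mul (x y : A) : gradingLin 𝒜 (x * y) = gradingLin 𝒜 x * gradingLin 𝒜 y := by
  obtain ⟨x₀, hx₀, x₁, hx₁, rfl⟩ := exists_even_add_odd 𝒜 x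
  obtain ⟨y₀, hy₀, y₁, hy₁, rfl⟩ := exists_even_add_odd 𝒜 y
  simp only [mul_add, add_mul, map_add, gradingLin_even hx₀, gradingLin_even hy₀,
    gradingLin_odd hx₁, gradingLin_odd hy₁, gradingLin_even (even_mul_even hx₀ hy₀),
    gradingLin_odd (even_mul_odd hx₀ hy₁), gradingLin_odd (odd_mul_even hx₁ hy₀),
    gradingLin_even (odd_mul_odd hx₁ hy₁), mul_neg, neg_mul]
  abel

variable (𝒜) in
/-- The grading automorphism, acting as `(-1)^i` on `𝒜 i`. -/
def gradingAut : A ≃ₐ[F] A :=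
  AlgEquiv.ofLinearEquiv
    (LinearEquiv.ofInvolutive (gradingLin 𝒜) gradingLin_gradingLin)
    (gradingLin_even (SetLike.one_mem_graded 𝒜)) gradingLin_mul

lemma gradingAut_even {x : A} (hx : x ∈ 𝒜 0) : gradingAut 𝒜 x = x := gradingLin_even hx

lemma gradingAut_odd {x : A} (hx : x ∈ 𝒜 1) : gradingAut 𝒜 x = -x := gradingLin_odd hx

lemma gradingAut_gradingAut (x : A) : gradingAut 𝒜 (gradingAut 𝒜 x) = x :=
  gradingLin_gradingLin x

lemma mem_even_of_gradingAut_eq (hchar : (2 : F) ≠ 0) {x : A} (h : gradingAut 𝒜 x = x) :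
    x ∈ 𝒜 0 := by
  obtain ⟨y, hy, z, hz, rfl⟩ := exists_even_add_odd 𝒜 x
  rw [map_add, gradingAut_even hy, gradingAut_odd hz] at h
  have h2 : (2 : F) • z = 0 := by
    rw [two_smul]; nth_rw 1 [← add_left_cancel h]; exact neg_add_cancel z
  rw [(smul_eq_zero.1 h2).resolve_left hchar, add_zero]
  exact hy

lemma mem_odd_of_gradingAut_eq_neg (hchar : (2 : F) ≠ 0) {x : A} (h : gradingAut 𝒜 x = -x) :
    x ∈ 𝒜 1 := by
  obtain ⟨y, hy, z, hz, rfl⟩ := exists_even_add_odd 𝒜 x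
  rw [map_add, gradingAut_even hy, gradingAut_odd hz, neg_add] at h
  have h2 : (2 : F) • y = 0 := by
    rw [two_smul]; nth_rw 1 [add_right_cancel h]; exact neg_add_cancel y
  rw [(smul_eq_zero.1 h2).resolve_left hchar, zero_add]
  exact hz

/-- A two-sided ideal stable under the grading automorphism is trivial. -/
lemma SuperSimple.eq_bot_or_eq_top (hchar : (2 : F) ≠ 0) (hsimple : SuperSimple F 𝒜)
    (I : TwoSidedIdeal A) (hI : ∀ x ∈ I, gradingAut 𝒜 x ∈ I) : I = ⊥ ∨ I = ⊤ := by
  refine hsimple.2 I fun x hx => ?_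
  have hsmul : ∀ (r : F), ∀ y ∈ I, r • y ∈ I := fun r y hy => by
    rw [Algebra.smul_def]; exact I.mul_mem_left _ _ hy
  have hx' := hI x hx
  obtain ⟨y, hy, z, hz, rfl⟩ := exists_even_add_odd 𝒜 x
  rw [map_add, gradingAut_even hy, gradingAut_odd hz] at hx'
  have hyI : y ∈ I := by
    have := hsmul (2⁻¹) _ (I.add_mem hx hx')
    rwa [add_add_add_comm, add_neg_cancel, add_zero, ← two_smul F y,
      inv_smul_smul₀ hchar] at this
  have hzI : z ∈ I := by simpa using I.sub_mem hx hyI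
  intro i
  fin_cases i
  · change ((DirectSum.decompose 𝒜 (y + z) 0 : 𝒜 0) : A) ∈ I
    simpa [DirectSum.decompose_of_mem_same 𝒜 hy,
      DirectSum.decompose_of_mem_ne 𝒜 hz (one_ne_zero (α := ZMod 2))] using hyI
  · change ((DirectSum.decompose 𝒜 (y + z) 1 : 𝒜 1) : A) ∈ I
    simpa [DirectSum.decompose_of_mem_same 𝒜 hz,
      DirectSum.decompose_of_mem_ne 𝒜 hy (zero_ne_one (α := ZMod 2))] using hzI

/-- A central simple superalgebra of even type has no proper nonzero two-sided ideals. -/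
lemma SuperSimple.isSimpleRing (hchar : (2 : F) ≠ 0) (hsimple : SuperSimple F 𝒜)
    (heven : EvenType F 𝒜) : IsSimpleRing A := by
  obtain ⟨w, hw⟩ := hsimple.1
  have : Nontrivial A := ⟨w, 0, hw⟩
  refine ⟨⟨fun I => ?_⟩⟩
  let J : TwoSidedIdeal A := I.comap (gradingAut 𝒜)
  have hJ : ∀ x, x ∈ J ↔ gradingAut 𝒜 x ∈ I := fun x => TwoSidedIdeal.mem_comap _
  rcases hsimple.eq_bot_or_eq_top hchar (I ⊓ J) fun x hx => by
      rw [TwoSidedIdeal.mem_inf, hJ] at hx ⊢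
      rw [gradingAut_gradingAut]
      exact hx.symm with hinf | hinf
  · rcases hsimple.eq_bot_or_eq_top hchar (I ⊔ J) fun x hx => by
        rw [TwoSidedIdeal.mem_sup] at hx ⊢
        obtain ⟨y, hy, z, hz, rfl⟩ := hx
        refine ⟨gradingAut 𝒜 z, (hJ z).1 hz, gradingAut 𝒜 y, (hJ _).2 ?_, ?_⟩
        · rwa [gradingAut_gradingAut]
        · rw [map_add, add_comm] with hsup | hsup
    · exact Or.inl (eq_bot_iff.2 (hsup ▸ le_sup_left))
    · exfalso
      have hzero : ∀ x, x ∈ I → x ∈ J → x = 0 := fun x hx hx' => by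
        have : x ∈ I ⊓ J := (TwoSidedIdeal.mem_inf A).2 ⟨hx, hx'⟩
        rwa [hinf, TwoSidedIdeal.mem_bot] at this
      obtain ⟨e, he, f, hf, hef⟩ := TwoSidedIdeal.mem_sup.1
        (show (1 : A) ∈ I ⊔ J from hsup ▸ trivial)
      have hprod : ∀ x ∈ I, ∀ y ∈ J, x * y = 0 ∧ y * x = 0 := fun x hx y hy =>
        ⟨hzero _ (I.mul_mem_right _ _ hx) (J.mul_mem_left _ _ hy),
          hzero _ (I.mul_mem_left _ _ hx) (J.mul_mem_right _ _ hy)⟩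
      have hecomm : ∀ y, e * y = y * e := fun y => by
        have h1 : e * y = e * y * e := by
          conv_lhs => rw [← mul_one (e * y), ← hef, mul_add,
            (hprod _ (I.mul_mem_right _ _ he) f hf).1, add_zero]
        have h2 : y * e = e * (y * e) := by
          conv_lhs => rw [← one_mul (y * e), ← hef, add_mul,
            (hprod _ (I.mul_mem_left _ _ he) f hf).2, add_zero]
        rw [h1, h2, mul_assoc]
      have hνe : gradingAut 𝒜 e = f := by
        have hsum : gradingAut 𝒜 e + gradingAut 𝒜 f = e + f := by
          rw [← map_add, hef, map_one]
        have hsub : gradingAut 𝒜 e - f = e - gradingAut 𝒜 f := by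
          rw [sub_eq_sub_iff_add_eq_add, hsum]
        refine sub_eq_zero.1 (hzero _ ?_ ?_)
        · rw [hsub]
          exact I.sub_mem he ((hJ f).1 hf)
        · refine J.sub_mem ((hJ _).2 ?_) hf
          rwa [gradingAut_gradingAut]
      have hodd : e - f ∈ 𝒜 1 := mem_odd_of_gradingAut_eq_neg hchar (by
        rw [map_sub, hνe, ← hνe, gradingAut_gradingAut, neg_sub])
      have hf1 : f = 1 - e := eq_sub_of_add_eq' hef
      have hef0 : e - f = 0 := heven _ hodd fun y => by
        simp only [hf1, sub_mul, mul_sub, hecomm y, one_mul, mul_one]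
      have hef' := sub_eq_zero.1 hef0
      have he0 : e = 0 := hzero e he (hef' ▸ hf)
      rw [← hef', he0, add_zero] at hef
      exact zero_ne_one hef
  · exact Or.inr (eq_top_iff.2 (hinf ▸ inf_le_left))

/-- The center of a supercentral superalgebra of even type is the base field. -/
lemma SuperCentral.isCentral (hcentral : SuperCentral F 𝒜) (hchar : (2 : F) ≠ 0)
    (heven : EvenType F 𝒜) : Algebra.IsCentral F A := by
  refine ⟨fun x hx => ?_⟩
  rw [Subalgebra.mem_center_iff] at hx
  obtain ⟨y, hy, z, hz, rfl⟩ := exists_even_add_odd 𝒜 x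
  have hν : ∀ w, w * (y - z) = (y - z) * w := fun w => by
    have := congrArg (gradingAut 𝒜) (hx (gradingAut 𝒜 w))
    simpa only [map_mul, map_add, gradingAut_gradingAut, gradingAut_even hy,
      gradingAut_odd hz, ← sub_eq_add_neg] using this
  have hz0 : z = 0 := heven z hz fun w => by
    have h2 : (2 : F) • (z * w) = (2 : F) • (w * z) := by
      have h3 : (y + z) * w - (y - z) * w = w * (y + z) - w * (y - z) := by rw [hx, hν]
      rw [← sub_mul, ← mul_sub, add_sub_sub_cancel] at h3
      rwa [two_smul, two_smul, ← add_mul, ← mul_add]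
    exact smul_right_injective A hchar h2
  rw [hz0, add_zero] at hx ⊢
  obtain ⟨c, rfl⟩ := hcentral 0 y hy fun j h _ => by simp [hx h]
  exact Subalgebra.algebraMap_mem _ c

end Grading

/-- A unit inducing a graded inner automorphism of a central algebra is homogeneous. -/
lemma exists_mem_of_conj_graded [Algebra.IsCentral F A] [Nontrivial A]
    (hchar : (2 : F) ≠ 0) {𝒜 : ZMod 2 → Submodule F A} [GradedAlgebra 𝒜] {φ : A ≃ₐ[F] A}
    (hφ𝒜 : ∀ i, ∀ x ∈ 𝒜 i, φ x ∈ 𝒜 i) {b : Aˣ} (hφ : ∀ x, φ x = b * x * (b⁻¹ : Aˣ)) :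
    ∃ j, (b : A) ∈ 𝒜 j := by
  have hν : ∀ x, φ (gradingAut 𝒜 x) = gradingAut 𝒜 (φ x) := fun x => by
    obtain ⟨y, hy, z, hz, rfl⟩ := exists_even_add_odd 𝒜 x
    simp only [map_add, map_neg, gradingAut_even hy, gradingAut_odd hz,
      gradingAut_even (hφ𝒜 0 y hy), gradingAut_odd (hφ𝒜 1 z hz)]
  have hφb : ∀ x, φ x * b = b * x := fun x => by rw [hφ, Units.inv_mul_cancel_right]
  obtain ⟨r, hr⟩ := (Algebra.IsCentral.mem_center_iff F).1
    (Subalgebra.mem_center_iff.2 fun y =>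
        show y * ((b⁻¹ : Aˣ) * gradingAut 𝒜 b) = (b⁻¹ : Aˣ) * gradingAut 𝒜 b * y by
      have h := congrArg (gradingAut 𝒜) (hφb (gradingAut 𝒜 y))
      rw [map_mul, map_mul, ← hν, gradingAut_gradingAut, hφ] at h
      rw [mul_assoc, ← h]
      simp only [mul_assoc, Units.inv_mul_cancel_left])
  have hνb : gradingAut 𝒜 b = r • (b : A) := by
    rw [Algebra.smul_def, Algebra.commutes, ← hr, Units.mul_inv_cancel_left]
  have hr2 : r * r = 1 := by
    have h := gradingAut_gradingAut (𝒜 := 𝒜) (b : A)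
    rw [hνb, map_smul, hνb, smul_smul] at h
    refine smul_left_injective F b.ne_zero ?_
    simpa using h
  rcases mul_self_eq_one_iff.1 hr2 with rfl | rfl
  · exact ⟨0, mem_even_of_gradingAut_eq hchar (by rw [hνb, one_smul])⟩
  · exact ⟨1, mem_odd_of_gradingAut_eq_neg hchar (by rw [hνb, neg_smul, one_smul])⟩

namespace IsSuperAntiAuto

variable {𝒜 : ZMod 2 → Submodule F A} {σ τ : A ≃ₗ[F] A}

lemma map_mem (hσ : IsSuperAntiAuto F 𝒜 σ) {i : ZMod 2} {x : A} (hx : x ∈ 𝒜 i) : σ x ∈ 𝒜 i :=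
  hσ.1 i x hx

lemma map_even_mul_even (hσ : IsSuperAntiAuto F 𝒜 σ) {x y : A} (hx : x ∈ 𝒜 0) (hy : y ∈ 𝒜 0) :
    σ (x * y) = σ y * σ x := by
  simpa using hσ.2 0 0 x hx y hy

lemma map_even_mul_odd (hσ : IsSuperAntiAuto F 𝒜 σ) {x y : A} (hx : x ∈ 𝒜 0) (hy : y ∈ 𝒜 1) :
    σ (x * y) = σ y * σ x := by
  simpa using hσ.2 0 1 x hx y hy

lemma map_odd_mul_even (hσ : IsSuperAntiAuto F 𝒜 σ) {x y : A} (hx : x ∈ 𝒜 1) (hy : y ∈ 𝒜 0) :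
    σ (x * y) = σ y * σ x := by
  simpa using hσ.2 1 0 x hx y hy

lemma map_odd_mul_odd (hσ : IsSuperAntiAuto F 𝒜 σ) {x y : A} (hx : x ∈ 𝒜 1) (hy : y ∈ 𝒜 1) :
    σ (x * y) = -(σ y * σ x) := by
  simpa [ZMod.val_one] using hσ.2 1 1 x hx y hy

variable [GradedAlgebra 𝒜]

lemma map_even_mul (hσ : IsSuperAntiAuto F 𝒜 σ) {x : A} (hx : x ∈ 𝒜 0) (y : A) :
    σ (x * y) = σ y * σ x := by
  obtain ⟨y₀, hy₀, y₁, hy₁, rfl⟩ := exists_even_add_odd 𝒜 y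
  simp only [mul_add, add_mul, map_add, hσ.map_even_mul_even hx hy₀, hσ.map_even_mul_odd hx hy₁]

lemma map_mul_even (hσ : IsSuperAntiAuto F 𝒜 σ) (x : A) {y : A} (hy : y ∈ 𝒜 0) :
    σ (x * y) = σ y * σ x := by
  obtain ⟨x₀, hx₀, x₁, hx₁, rfl⟩ := exists_even_add_odd 𝒜 x
  simp only [mul_add, add_mul, map_add, hσ.map_even_mul_even hx₀ hy, hσ.map_odd_mul_even hx₁ hy]

lemma map_one (hσ : IsSuperAntiAuto F 𝒜 σ) : σ 1 = 1 := by
  have := hσ.map_even_mul (SetLike.one_mem_graded 𝒜) (σ.symm 1)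
  rwa [one_mul, σ.apply_symm_apply, one_mul, eq_comm] at this

lemma map_algebraMap (hσ : IsSuperAntiAuto F 𝒜 σ) (r : F) :
    σ (algebraMap F A r) = algebraMap F A r := by
  rw [Algebra.algebraMap_eq_smul_one, map_smul, hσ.map_one]

lemma map_gradingAut (hσ : IsSuperAntiAuto F 𝒜 σ) (x : A) :
    σ (gradingAut 𝒜 x) = gradingAut 𝒜 (σ x) := by
  obtain ⟨y, hy, z, hz, rfl⟩ := exists_even_add_odd 𝒜 x
  simp only [map_add, gradingAut_even hy, gradingAut_odd hz, gradingAut_even (hσ.map_mem hy),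
    gradingAut_odd (hσ.map_mem hz), map_neg]

lemma symm (hσ : IsSuperAntiAuto F 𝒜 σ) (hchar : (2 : F) ≠ 0) : IsSuperAntiAuto F 𝒜 σ.symm := by
  have hν : ∀ x, gradingAut 𝒜 (σ.symm x) = σ.symm (gradingAut 𝒜 x) := fun x => by
    rw [LinearEquiv.eq_symm_apply, hσ.map_gradingAut, σ.apply_symm_apply]
  have hmem : ∀ (i : ZMod 2), ∀ x ∈ 𝒜 i, σ.symm x ∈ 𝒜 i := by
    intro i x hx
    fin_cases i
    · exact mem_even_of_gradingAut_eq hchar (by rw [hν, gradingAut_even hx])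
    · exact mem_odd_of_gradingAut_eq_neg hchar (by rw [hν, gradingAut_odd hx, map_neg])
  refine ⟨hmem, fun i j x hx y hy => ?_⟩
  rw [LinearEquiv.symm_apply_eq, map_smul, hσ.2 j i _ (hmem j y hy) _ (hmem i x hx), smul_smul,
    mul_comm j.val, ← mul_pow]
  simp

/-- The composite of two superantiautomorphisms is an automorphism. -/
def transAlgEquiv (hσ : IsSuperAntiAuto F 𝒜 σ) (hτ : IsSuperAntiAuto F 𝒜 τ) : A ≃ₐ[F] A :=
  AlgEquiv.ofLinearEquiv (σ.trans τ)
    (by rw [LinearEquiv.trans_apply, hσ.map_one, hτ.map_one])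
    (fun x y => by
      obtain ⟨x₀, hx₀, x₁, hx₁, rfl⟩ := exists_even_add_odd 𝒜 x
      obtain ⟨y₀, hy₀, y₁, hy₁, rfl⟩ := exists_even_add_odd 𝒜 y
      simp only [LinearEquiv.trans_apply, mul_add, add_mul, map_add, hσ.map_even_mul_even hx₀ hy₀,
        hσ.map_even_mul_odd hx₀ hy₁, hσ.map_odd_mul_even hx₁ hy₀, hσ.map_odd_mul_odd hx₁ hy₁,
        hτ.map_even_mul_even (hσ.map_mem hy₀) (hσ.map_mem hx₀),
        hτ.map_even_mul_odd (hσ.map_mem hy₀) (hσ.map_mem hx₁),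
        hτ.map_odd_mul_even (hσ.map_mem hy₁) (hσ.map_mem hx₀),
        hτ.map_odd_mul_odd (hσ.map_mem hy₁) (hσ.map_mem hx₁), map_neg, neg_neg])

lemma transAlgEquiv_apply (hσ : IsSuperAntiAuto F 𝒜 σ) (hτ : IsSuperAntiAuto F 𝒜 τ) (x : A) :
    hσ.transAlgEquiv hτ x = τ (σ x) := rfl

/-- If `σ ∘ σ` is conjugation by the even unit `a`, then `σ a * a` is central. -/
lemma map_mul_self_comm (hσ : IsSuperAntiAuto F 𝒜 σ) {a : Aˣ} (ha : (a : A) ∈ 𝒜 0)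
    (h : ∀ x, σ (σ x) = a * x * (a⁻¹ : Aˣ)) (y : A) : σ a * a * y = y * (σ a * a) := by
  obtain ⟨x, rfl⟩ := σ.surjective y
  have h1 : ∀ z, σ (σ z) * a = a * z := fun z => by rw [h, Units.inv_mul_cancel_right]
  have h2 := congrArg σ (h1 x)
  rw [hσ.map_mul_even _ ha, hσ.map_even_mul ha] at h2
  rw [mul_assoc, ← h1, ← mul_assoc, h2, mul_assoc]

lemma exists_map_mul_self_eq [Nontrivial A] (hcentral : SuperCentral F 𝒜)
    (hσ : IsSuperAntiAuto F 𝒜 σ) {a : Aˣ} (ha : (a : A) ∈ 𝒜 0)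
    (h : ∀ x, σ (σ x) = a * x * (a⁻¹ : Aˣ)) :
    ∃ c : F, c ≠ 0 ∧ σ a * a = algebraMap F A c ∧ a * σ a = algebraMap F A c := by
  obtain ⟨c, hc⟩ := hcentral 0 _ (even_mul_even (hσ.map_mem ha) ha) fun j y _ => by
    simpa using hσ.map_mul_self_comm ha h y
  refine ⟨c, ?_, hc, ?_⟩
  · rintro rfl
    rw [_root_.map_zero, Units.mul_left_eq_zero, map_eq_zero_iff σ σ.injective] at hc
    exact a.ne_zero hc
  · have := hσ.map_mul_self_comm ha h a
    rw [← mul_assoc (a : A), Units.mul_left_inj] at this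
    rw [← this, hc]

lemma mem_even_of_sq_eq_conj [IsSimpleRing A] [Algebra.IsCentral F A] [FiniteDimensional F A]
    (hchar : (2 : F) ≠ 0) (hσ : IsSuperAntiAuto F 𝒜 σ) {a : Aˣ}
    (h : ∀ x, σ (σ x) = a * x * (a⁻¹ : Aˣ)) : (a : A) ∈ 𝒜 0 := by
  obtain ⟨u, hu⟩ := (gradingAut 𝒜).exists_eq_conj
  have hu0 : (u : A) ∈ 𝒜 0 :=
    mem_even_of_gradingAut_eq hchar (by rw [hu, Units.mul_inv_cancel_right])
  have hux : ∀ x, gradingAut 𝒜 x * u = u * x := fun x => by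
    rw [hu, Units.inv_mul_cancel_right]
  obtain ⟨r, hr⟩ := (Algebra.IsCentral.mem_center_iff F).1
    (Subalgebra.mem_center_iff.2 fun y => show y * (σ u * u) = σ u * u * y by
      obtain ⟨x, rfl⟩ := σ.surjective y
      have h2 := congrArg σ (hux x)
      rw [hσ.map_mul_even _ hu0, hσ.map_even_mul hu0, hσ.map_gradingAut] at h2
      rw [← mul_assoc, ← h2, mul_assoc, hux, mul_assoc])
  have hr0 : r ≠ 0 := by
    rintro rfl
    rw [_root_.map_zero, Units.mul_left_eq_zero, map_eq_zero_iff σ σ.injective] at hr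
    exact u.ne_zero hr
  have hσu : IsUnit (σ u) := by
    rw [← Units.isUnit_mul_units _ u, hr]
    exact hr0.isUnit.map (algebraMap F A)
  have h4 : σ (σ u) = u := hσu.mul_left_cancel (by
    rw [← hσ.map_mul_even _ hu0, hr, hσ.map_algebraMap])
  refine mem_even_of_gradingAut_eq hchar ?_
  rw [hu, Units.mul_inv_eq_iff_eq_mul]
  rw [h, Units.mul_inv_eq_iff_eq_mul] at h4
  exact h4.symm

/-- `σ` turns conjugation by a homogeneous element into conjugation in the opposite direction,
without signs. -/
lemma map_mul_map_conj (hσ : IsSuperAntiAuto F 𝒜 σ) {b : A} {j : ZMod 2} (hb : b ∈ 𝒜 j)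
    {φ : A ≃ₐ[F] A} (hφ𝒜 : ∀ i, ∀ x ∈ 𝒜 i, φ x ∈ 𝒜 i) (hφ : ∀ x, φ x * b = b * x) (x : A) :
    σ b * σ (φ x) = σ x * σ b := by
  have key : ∀ i, ∀ x ∈ 𝒜 i, σ b * σ (φ x) = σ x * σ b := fun i x hx => by
    have h := congrArg σ (hφ x)
    rw [hσ.2 i j _ (hφ𝒜 i x hx) _ hb, hσ.2 j i _ hb _ hx, mul_comm j.val] at h
    exact smul_right_injective A (pow_ne_zero _ (neg_ne_zero.2 one_ne_zero)) h
  obtain ⟨y, hy, z, hz, rfl⟩ := exists_even_add_odd 𝒜 x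
  simp only [map_add, mul_add, add_mul, key 0 y hy, key 1 z hz]

/-- The square class of `a * σ a` does not depend on the superantiautomorphism `σ`. -/
lemma exists_sq_mul_eq [IsSimpleRing A] [Algebra.IsCentral F A] [FiniteDimensional F A]
    (hchar : (2 : F) ≠ 0) (hcentral : SuperCentral F 𝒜)
    (hσ : IsSuperAntiAuto F 𝒜 σ) (hτ : IsSuperAntiAuto F 𝒜 τ) {a c : Aˣ}
    (ha : (a : A) ∈ 𝒜 0) (hc : (c : A) ∈ 𝒜 0)
    (hσa : ∀ x, σ (σ x) = a * x * (a⁻¹ : Aˣ)) (hτc : ∀ x, τ (τ x) = c * x * (c⁻¹ : Aˣ))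
    {α β : F} (hα : a * σ a = algebraMap F A α) (hβ : c * τ c = algebraMap F A β) :
    ∃ s : F, s ≠ 0 ∧ α = s ^ 2 * β := by
  let φ := (hσ.symm hchar).transAlgEquiv hτ
  have hφσ : ∀ x, φ (σ x) = τ x := fun x => by
    rw [transAlgEquiv_apply, σ.symm_apply_apply]
  have hφ𝒜 : ∀ i, ∀ x ∈ 𝒜 i, φ x ∈ 𝒜 i := fun i x hx =>
    hτ.map_mem ((hσ.symm hchar).map_mem hx)
  obtain ⟨b, hφb⟩ := φ.exists_eq_conj
  have hφb' : ∀ x, φ x * b = b * x := fun x => by rw [hφb, Units.inv_mul_cancel_right]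
  obtain ⟨j, hb⟩ := exists_mem_of_conj_graded hchar hφ𝒜 hφb
  have hconj := hσ.map_mul_map_conj hb hφ𝒜 hφb'
  have hσb0 : σ b ≠ 0 := (map_ne_zero_iff σ σ.injective).2 b.ne_zero
  obtain ⟨g, hg⟩ : IsUnit (σ b) := isUnit_of_forall_exists_mul_eq (F := F) hσb0 fun x =>
    ⟨σ (φ (σ.symm x)), by rw [hconj, σ.apply_symm_apply]⟩
  have hτ' : ∀ x, τ x = b * σ x * (b⁻¹ : Aˣ) := fun x => by rw [← hφσ, hφb]
  let w : Aˣ := b * g⁻¹ * a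
  have hτw : ∀ x, τ (τ x) = w * x * (w⁻¹ : Aˣ) := fun x => by
    have h := hconj (σ x)
    rw [hφσ, ← hg, hσa] at h
    rw [hτ' (τ x), ← Units.inv_mul_cancel_left g (σ (τ x)), h]
    simp [w, mul_assoc]
  obtain ⟨t, ht⟩ := (Algebra.IsCentral.mem_center_iff F).1
    (Subalgebra.mem_center_iff.2 fun y =>
        show y * (((w⁻¹ : Aˣ) : A) * c) = ((w⁻¹ : Aˣ) : A) * c * y by
      have h := (hτw y).symm.trans (hτc y)
      rw [Units.eq_mul_inv_iff_mul_eq] at h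
      rw [mul_assoc, ← h]
      simp only [mul_assoc, Units.inv_mul_cancel_left])
  have hcw : (c : A) = t • (w : A) := by
    rw [Algebra.smul_def, Algebra.commutes, ← ht, Units.mul_inv_cancel_left]
  have ht0 : t ≠ 0 := by
    rintro rfl
    exact c.ne_zero (by rw [hcw, zero_smul])
  have hw : (w : A) ∈ 𝒜 0 := by
    rw [← inv_smul_smul₀ ht0 (w : A), ← hcw]
    exact (𝒜 0).smul_mem _ hc
  have hσaa : σ a * a = algebraMap F A α := by
    obtain ⟨r, -, h1, h2⟩ := hσ.exists_map_mul_self_eq hcentral ha hσa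
    rw [h1, ← h2, hα]
  have hσa' : σ a = α • ((a⁻¹ : Aˣ) : A) := by
    rw [(Units.eq_mul_inv_iff_mul_eq a).2 hσaa, Algebra.smul_def]
  have hk : ((b * g⁻¹ : Aˣ) : A) ∈ 𝒜 0 := mem_even_of_gradingAut_eq hchar (by
    rw [← Units.mul_left_inj a]
    nth_rw 1 [← gradingAut_even ha]
    rw [← map_mul, ← Units.val_mul, gradingAut_even hw])
  have hσk : a * b * (a⁻¹ : Aˣ) * σ (b * g⁻¹ : Aˣ) = g := by
    rw [← hσa, ← hg, ← hσ.map_even_mul hk, ← Units.val_mul, inv_mul_cancel_right, hg]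
  have hww : (w : A) * τ w = algebraMap F A α := by
    rw [hτ', show (w : A) = (b * g⁻¹ : Aˣ) * (a : A) from rfl, hσ.map_even_mul hk, hσa']
    calc _ = α • (((b * g⁻¹ : Aˣ) : A) * (a * b * (a⁻¹ : Aˣ) * σ (b * g⁻¹ : Aˣ)) *
          (b⁻¹ : Aˣ)) := by simp only [mul_assoc, smul_mul_assoc, mul_smul_comm]
      _ = algebraMap F A α := by
        rw [hσk, ← Units.val_mul, inv_mul_cancel_right, Units.mul_inv,
          Algebra.algebraMap_eq_smul_one]
  have hβα : β = t * t * α := by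
    apply (algebraMap F A).injective
    rw [← hβ, hcw, map_smul, smul_mul_smul_comm, hww, Algebra.smul_def, ← map_mul]
  exact ⟨t⁻¹, inv_ne_zero ht0, by rw [hβα]; field_simp⟩

end IsSuperAntiAuto

end Superalgebra

/-- For a central simple superalgebra of even type with a superantiautomorphism `η`:
`η²` is conjugation by an invertible even element `a`; any such `a` satisfies
`a·η(a) = η(a)·a ∈ F^×`; and the square class of `a·η(a)` is independent of the choice of
the superantiautomorphism. -/
theorem superantiauto_square_invariant
    (F : Type*) {A : Type*} [Field F] [Ring A] [Algebra F A]
    (hchar : (2 : F) ≠ 0)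
    (𝒜 : ZMod 2 → Submodule F A) [GradedAlgebra 𝒜]
    (hfin : FiniteDimensional F A)
    (hcentral : SuperCentral F 𝒜)
    (hsimple : SuperSimple F 𝒜)
    (heven : EvenType F 𝒜)
    (η : A ≃ₗ[F] A) (hη : IsSuperAntiAuto F 𝒜 η) :
    (∃ a : Aˣ, (a : A) ∈ 𝒜 0 ∧ ∀ x : A, η (η x) = (a : A) * x * ((a⁻¹ : Aˣ) : A)) ∧
    (∀ a : Aˣ, (a : A) ∈ 𝒜 0 → (∀ x : A, η (η x) = (a : A) * x * ((a⁻¹ : Aˣ) : A)) →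
      (a : A) * η a = η a * (a : A) ∧
      ∃ c : F, c ≠ 0 ∧ (a : A) * η a = algebraMap F A c) ∧
    (∀ (ξ : A ≃ₗ[F] A), IsSuperAntiAuto F 𝒜 ξ →
      ∀ (a c : Aˣ), (a : A) ∈ 𝒜 0 → (c : A) ∈ 𝒜 0 →
      (∀ x : A, η (η x) = (a : A) * x * ((a⁻¹ : Aˣ) : A)) →
      (∀ x : A, ξ (ξ x) = (c : A) * x * ((c⁻¹ : Aˣ) : A)) →
      ∀ α β : F, (a : A) * η a = algebraMap F A α → (c : A) * ξ c = algebraMap F A β →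
        ∃ s : F, s ≠ 0 ∧ α = s ^ 2 * β) := by
  have := hsimple.isSimpleRing hchar heven
  have := hcentral.isCentral hchar heven
  refine ⟨?_, fun a ha h => ?_, fun ξ hξ a c ha hc hηa hξc α β hα hβ => ?_⟩
  · obtain ⟨a, ha⟩ := (hη.transAlgEquiv hη).exists_eq_conj
    exact ⟨a, hη.mem_even_of_sq_eq_conj hchar ha, ha⟩
  · obtain ⟨c, hc0, hc, hc'⟩ := hη.exists_map_mul_self_eq hcentral ha h
    exact ⟨hc'.trans hc.symm, c, hc0, hc'⟩
  · exact hη.exists_sq_mul_eq hchar hcentral hξ ha hc hηa hξc hα hβ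
end

section
/- Let K = F(θ) be a quadratic field extension of F with θ̄ = −θ, and let μ ∈ K^×. The quadratic graded K-algebra A = K⟨√μ⟩ = K·1 ⊕ K·u (u² = μ, u odd) has a K/F-superinvolution if and only if there exists an odd element v ∈ A₁ with v² ∈ F^×·θ. -/
section KF

variable (F K : Type*) [Field F] [Field K] [Algebra F K] (conj : K ≃ₐ[F] K)
variable {B : Type*} [Ring B] [Algebra K B] (ℬ : ZMod 2 → Submodule K B)

/-- A `K/F`-superinvolution: a graded additive bijection which is `conj`-semilinear,
reverses products with the Koszul sign, and has order two. -/
def IsKFSuperInvolution (ξ : B ≃+ B) : Prop :=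
  (∀ (lam : K) (x : B), ξ (lam • x) = conj lam • ξ x) ∧
  (∀ (i : ZMod 2), ∀ x ∈ ℬ i, ξ x ∈ ℬ i) ∧
  (∀ (i j : ZMod 2), ∀ x ∈ ℬ i, ∀ y ∈ ℬ j,
    ξ (x * y) = ((-1 : K) ^ (i.val * j.val)) • (ξ y * ξ x)) ∧
  (∀ x, ξ (ξ x) = x)

end KF

section Helpers

variable {F K : Type*} [Field F] [Field K] [Algebra F K]

/-- Elements negated by the nontrivial automorphism of `F(θ)` lie in `F·θ`. -/
lemma exists_eq_algebraMap_mul_of_conj_eq_neg (hchar : (2 : F) ≠ 0) {θ : K}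
    (hspan : ∀ x : K, ∃ c d : F, x = algebraMap F K c + algebraMap F K d * θ)
    {conj : K ≃ₐ[F] K} (hconj : conj θ = -θ) {x : K} (hx : conj x = -x) :
    ∃ d : F, x = algebraMap F K d * θ := by
  obtain ⟨c, d, rfl⟩ := hspan x
  have h2 : algebraMap F K 2 * algebraMap F K c = 0 := by
    simp only [map_add, map_mul, AlgEquiv.commutes, hconj, map_ofNat] at hx ⊢
    linear_combination hx
  rw [← map_mul, map_eq_zero] at h2
  have hc : c = 0 := (mul_eq_zero.mp h2).resolve_left hchar
  exact ⟨d, by simp [hc]⟩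

/-- The nontrivial automorphism of `F(θ)` is an involution. -/
lemma conj_conj_of_conj_eq_neg {θ : K}
    (hspan : ∀ x : K, ∃ c d : F, x = algebraMap F K c + algebraMap F K d * θ)
    {conj : K ≃ₐ[F] K} (hconj : conj θ = -θ) (x : K) : conj (conj x) = x := by
  obtain ⟨c, d, rfl⟩ := hspan x
  simp [hconj]

/-- Hilbert 90 for an involution which negates some nonzero element. -/
lemma exists_ne_zero_conj_mul_eq {θ : K} (hθ : θ ≠ 0) {conj : K ≃ₐ[F] K} (hconj : conj θ = -θ)
    {a : K} (ha : conj a * a = 1) : ∃ t : K, t ≠ 0 ∧ conj t * a = t := by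
  by_cases h : 1 + a = 0
  · refine ⟨θ, hθ, ?_⟩
    rw [hconj, eq_neg_of_add_eq_zero_right h]
    ring
  · refine ⟨1 + a, h, ?_⟩
    rw [map_add, map_one]
    linear_combination ha

variable {A : Type*} [Ring A] [Algebra K A] {𝒜 : ZMod 2 → Submodule K A}

lemma IsKFSuperInvolution.map_one [GradedAlgebra 𝒜] {conj : K ≃ₐ[F] K} {ξ : A ≃+ A}
    (hξ : IsKFSuperInvolution F K conj 𝒜 ξ) : ξ 1 = 1 := by
  obtain ⟨-, hgr, hmul, hinv⟩ := hξ
  have h1 : (1 : A) ∈ 𝒜 0 := SetLike.GradedOne.one_mem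
  have h := hmul 0 0 (ξ 1) (hgr 0 1 h1) 1 h1
  simpa [hinv] using h.symm

/-- A graded algebra with components `K·1` and `K·v`, where `v ≠ 0`, has coordinates `K × K`. -/
lemma exists_linearEquiv_prod_of_span [GradedAlgebra 𝒜] [Nontrivial A] {v : A} (hv : v ≠ 0)
    (h0 : 𝒜 0 = Submodule.span K {1}) (h1 : 𝒜 1 = Submodule.span K {v}) :
    ∃ e : (K × K) ≃ₗ[K] A, ∀ x y, e (x, y) = x • (1 : A) + y • v := by
  let L : (K × K) →ₗ[K] A :=
    (LinearMap.toSpanSingleton K A 1).coprod (LinearMap.toSpanSingleton K A v)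
  have hL : ∀ x y, L (x, y) = x • (1 : A) + y • v := fun x y => by simp [L]
  have hinj : Function.Injective L := by
    rw [← LinearMap.ker_eq_bot, LinearMap.ker_eq_bot']
    rintro ⟨x, y⟩ h
    rw [hL] at h
    have hx0 : x • (1 : A) ∈ 𝒜 0 := by
      rw [h0]; exact Submodule.smul_mem _ _ (Submodule.mem_span_singleton_self _)
    have hx1 : x • (1 : A) ∈ 𝒜 1 := by
      rw [h1, eq_neg_of_add_eq_zero_left h]
      exact neg_mem (Submodule.smul_mem _ _ (Submodule.mem_span_singleton_self _))
    have hx : x • (1 : A) = 0 := by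
      rw [← DirectSum.decompose_of_mem_same 𝒜 hx0]
      exact DirectSum.decompose_of_mem_ne 𝒜 hx1 one_ne_zero
    rw [hx, zero_add] at h
    exact Prod.ext ((smul_eq_zero.mp hx).resolve_right one_ne_zero)
      ((smul_eq_zero.mp h).resolve_right hv)
  have hsurj : Function.Surjective L := by
    intro a
    induction a using DirectSum.Decomposition.inductionOn 𝒜 with
    | zero => exact ⟨0, map_zero _⟩
    | @homogeneous i m =>
      obtain ⟨m, hm⟩ := m
      obtain rfl | rfl : i = 0 ∨ i = 1 := (by decide : ∀ k : ZMod 2, k = 0 ∨ k = 1) i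
      · obtain ⟨x, rfl⟩ := Submodule.mem_span_singleton.mp (h0 ▸ hm)
        exact ⟨(x, 0), by simp [hL]⟩
      · obtain ⟨y, rfl⟩ := Submodule.mem_span_singleton.mp (h1 ▸ hm)
        exact ⟨(0, y), by simp [hL]⟩
    | add m n hm hn =>
      obtain ⟨p, rfl⟩ := hm
      obtain ⟨q, rfl⟩ := hn
      exact ⟨p + q, map_add _ _ _⟩
  exact ⟨LinearEquiv.ofBijective L ⟨hinj, hsurj⟩, hL⟩

/-- If `v` is odd and `v²` is negated by `conj`, then `x + y v ↦ conj x + conj y v` is a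
superinvolution. -/
lemma exists_isKFSuperInvolution_of_conj_sq_eq_neg [GradedAlgebra 𝒜] [Nontrivial A]
    {conj : K ≃ₐ[F] K} (hcc : ∀ x, conj (conj x) = x) {v : A} (hv : v ≠ 0) {ν : K}
    (hν : conj ν = -ν) (hv2 : v * v = algebraMap K A ν)
    (h0 : 𝒜 0 = Submodule.span K {1}) (h1 : 𝒜 1 = Submodule.span K {v}) :
    ∃ ξ : A ≃+ A, IsKFSuperInvolution F K conj 𝒜 ξ := by
  obtain ⟨e, he⟩ := exists_linearEquiv_prod_of_span hv h0 h1
  let ξ : A ≃+ A := (e.symm.toAddEquiv.trans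
    (AddEquiv.prodCongr conj.toAddEquiv conj.toAddEquiv)).trans e.toAddEquiv
  have hξe : ∀ x y, ξ (e (x, y)) = e (conj x, conj y) := fun x y => by
    simp [ξ]
    rfl
  have hξ0 : ∀ x : K, ξ (x • (1 : A)) = conj x • (1 : A) := fun x => by
    simpa [he] using hξe x 0
  have hξ1 : ∀ y : K, ξ (y • v) = conj y • v := fun y => by
    simpa [he] using hξe 0 y
  have hmem : ∀ i, ∀ x ∈ 𝒜 i,
      (i = 0 ∧ ∃ a : K, x = a • (1 : A)) ∨ (i = 1 ∧ ∃ a : K, x = a • v) := by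
    intro i x hx
    obtain rfl | rfl : i = 0 ∨ i = 1 := (by decide : ∀ k : ZMod 2, k = 0 ∨ k = 1) i
    · obtain ⟨a, rfl⟩ := Submodule.mem_span_singleton.mp (h0 ▸ hx)
      exact Or.inl ⟨rfl, a, rfl⟩
    · obtain ⟨a, rfl⟩ := Submodule.mem_span_singleton.mp (h1 ▸ hx)
      exact Or.inr ⟨rfl, a, rfl⟩
  rw [Algebra.algebraMap_eq_smul_one] at hv2
  refine ⟨ξ, fun l x => ?_, fun i x hx => ?_, fun i j x hx y hy => ?_, fun x => ?_⟩
  · obtain ⟨⟨a, b⟩, rfl⟩ := e.surjective x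
    rw [← map_smul, Prod.smul_mk, hξe, hξe, ← map_smul]
    simp
  · obtain ⟨rfl, a, rfl⟩ | ⟨rfl, a, rfl⟩ := hmem i x hx
    · rw [hξ0, h0]; exact Submodule.smul_mem _ _ (Submodule.mem_span_singleton_self _)
    · rw [hξ1, h1]; exact Submodule.smul_mem _ _ (Submodule.mem_span_singleton_self _)
  · obtain ⟨rfl, a, rfl⟩ | ⟨rfl, a, rfl⟩ := hmem i x hx <;>
      obtain ⟨rfl, b, rfl⟩ | ⟨rfl, b, rfl⟩ := hmem j y hy <;>
      simp [smul_smul, hξ0, hξ1, hv2, hν, mul_comm, mul_left_comm, ZMod.val_one]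
  · obtain ⟨⟨a, b⟩, rfl⟩ := e.surjective x
    rw [hξe, hξe, hcc, hcc]

end Helpers

/-- The quadratic graded `K`-algebra `K⟨√μ⟩` (presented by `A₀ = K·1`, `A₁ = K·u`,
`u² = μ`) has a `K/F`-superinvolution if and only if there exists an odd element `v` with
`v² ∈ F^×·θ`. -/
theorem quadratic_graded_KF_superinvolution_iff
    (F K : Type*) [Field F] [Field K] [Algebra F K]
    (hchar : (2 : F) ≠ 0)
    (θ : K)
    (hθsq : ∃ c : F, c ≠ 0 ∧ θ ^ 2 = algebraMap F K c ∧ ∀ d : F, d ^ 2 ≠ c)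
    (hspan : ∀ x : K, ∃ c d : F, x = algebraMap F K c + algebraMap F K d * θ)
    (conj : K ≃ₐ[F] K) (hconj : conj θ = -θ)
    {A : Type*} [Ring A] [Algebra K A]
    (𝒜 : ZMod 2 → Submodule K A) [GradedAlgebra 𝒜]
    (μ : K) (hμ : μ ≠ 0)
    (u : A) (hu : u ∈ 𝒜 1)
    (hu2 : u * u = algebraMap K A μ)
    (h0 : 𝒜 0 = Submodule.span K {1})
    (h1 : 𝒜 1 = Submodule.span K {u}) :
    (∃ ξ : A ≃+ A, IsKFSuperInvolution F K conj 𝒜 ξ) ↔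
      (∃ v ∈ 𝒜 1, ∃ c : F, c ≠ 0 ∧ v * v = algebraMap K A (algebraMap F K c * θ)) := by
  have hθ : θ ≠ 0 := by
    obtain ⟨c, hc, hθc, -⟩ := hθsq
    rintro rfl
    exact hc (by simpa using hθc.symm)
  have hcc := conj_conj_of_conj_eq_neg hspan hconj
  cases subsingleton_or_nontrivial A with
  | inl _ =>
    refine iff_of_true ⟨AddEquiv.refl A, ?_, fun _ _ h => h, ?_, ?_⟩
      ⟨u, hu, 1, one_ne_zero, Subsingleton.elim _ _⟩ <;> intros <;> exact Subsingleton.elim _ _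
  | inr _ =>
  have hinj : Function.Injective (algebraMap K A) := FaithfulSMul.algebraMap_injective K A
  constructor
  · rintro ⟨ξ, hξ⟩
    have hξ1 : ξ 1 = 1 := hξ.map_one
    obtain ⟨hsemi, hgr, hmul, hinv⟩ := hξ
    have hu0 : u ≠ 0 := by
      rintro rfl
      exact hμ (hinj (by simpa using hu2.symm))
    obtain ⟨a, ha⟩ := Submodule.mem_span_singleton.mp (h1 ▸ hgr 1 u hu)
    have haa : conj a * a = 1 := by
      have h := hinv u
      rw [← ha, hsemi, ← ha, smul_smul] at h
      exact smul_left_injective K hu0 (by simpa using h)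
    have hμa : conj μ = -(a * a * μ) := by
      have h := hmul 1 1 u hu u hu
      rw [hu2, Algebra.algebraMap_eq_smul_one, hsemi, hξ1, ← ha, smul_mul_smul_comm, hu2] at h
      apply hinj
      simpa [Algebra.algebraMap_eq_smul_one, ZMod.val_one, smul_smul] using h
    obtain ⟨t, ht0, ht⟩ := exists_ne_zero_conj_mul_eq hθ hconj haa
    have hneg : conj (t * t * μ) = -(t * t * μ) := by
      rw [map_mul, map_mul, hμa]
      linear_combination (-(conj t * a + t) * μ) * ht
    obtain ⟨d, hd⟩ := exists_eq_algebraMap_mul_of_conj_eq_neg hchar hspan hconj hneg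
    refine ⟨t • u, Submodule.smul_mem _ _ hu, d, ?_, ?_⟩
    · rintro rfl
      exact mul_ne_zero (mul_ne_zero ht0 ht0) hμ (by simpa using hd)
    · rw [← hd, smul_mul_smul_comm, hu2, map_mul, Algebra.smul_def]
  · rintro ⟨v, hv, c, hc, hvc⟩
    have hv0 : v ≠ 0 := by
      rintro rfl
      have h : algebraMap F K c * θ = 0 := hinj (by simpa using hvc.symm)
      exact mul_ne_zero (by simpa using hc) hθ h
    obtain ⟨t, rfl⟩ := Submodule.mem_span_singleton.mp (h1 ▸ hv)
    have ht : IsUnit t := (left_ne_zero_of_smul hv0).isUnit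
    refine exists_isKFSuperInvolution_of_conj_sq_eq_neg hcc hv0 ?_ hvc h0
      (h1.trans (Submodule.span_singleton_smul_eq ht u).symm)
    simp [hconj]
end
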